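/- arXiv:hep-th/9804061 — 2 statements merged into one kernel-verified Lean document; each statement's English description precedes it below -/
import Mathlib

section
/- For every integer N ≥ 2, let ι : SU(N) ↪ Sp(2N) be the embedding U ↦ diag(U, Ū). The image of the induced homomorphism ι₊ : π₃(SU(N), 1) → π₃(Sp(2N), 1) on third homotopy groups equals the subgroup {x² : x ∈ π₃(Sp(2N), 1)} of squares of elements of π₃(Sp(2N), 1). (In particular, since π₃(Sp(2N)) ≅ ℤ, the image is the index-2 subgroup.) -/
open Matrix
open scoped Topology Topology.Homotopy

noncomputable section

/-- The special unitary group `SU(n)`, i.e. the group of unitary `n×n` complex matrices of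
determinant one, as a subgroup of the unitary group (so that its topology is the subspace
topology from the `n×n` complex matrices). -/
def SU (n : ℕ) : Subgroup (Matrix.unitaryGroup (Fin n) ℂ) :=
  (Matrix.detMonoidHom.comp (Matrix.unitaryGroup (Fin n) ℂ).subtype).ker

/-- The standard symplectic form `J = [[0, Iₙ], [−Iₙ, 0]]` on `ℂ^(n ⊕ n)`. -/
def Jmat (n : ℕ) : Matrix (Fin n ⊕ Fin n) (Fin n ⊕ Fin n) ℂ :=
  fromBlocks 0 1 (-1) 0

/-- The compact symplectic group `Sp(2n) = Sp(2n, ℂ) ∩ U(2n)`, i.e. the subgroup of the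
unitary group of `2n×2n` complex matrices consisting of those `A` with `Aᵀ J A = J`. -/
def Sp (n : ℕ) : Subgroup (Matrix.unitaryGroup (Fin n ⊕ Fin n) ℂ) where
  carrier := {A | (A : Matrix (Fin n ⊕ Fin n) (Fin n ⊕ Fin n) ℂ)ᵀ * Jmat n *
    (A : Matrix (Fin n ⊕ Fin n) (Fin n ⊕ Fin n) ℂ) = Jmat n}
  one_mem' := by simp
  mul_mem' := by
    intro a b ha hb
    simp only [Set.mem_setOf_eq, Submonoid.coe_mul] at *
    calc ((a : Matrix _ _ ℂ) * (b : Matrix _ _ ℂ))ᵀ * Jmat n *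
          ((a : Matrix _ _ ℂ) * (b : Matrix _ _ ℂ))
        = (b : Matrix _ _ ℂ)ᵀ * ((a : Matrix _ _ ℂ)ᵀ * Jmat n * (a : Matrix _ _ ℂ)) *
          (b : Matrix _ _ ℂ) := by rw [transpose_mul]; simp only [Matrix.mul_assoc]
      _ = Jmat n := by rw [ha, hb]
  inv_mem' := by
    intro a ha
    simp only [Set.mem_setOf_eq] at *
    have h2 : (a : Matrix _ _ ℂ) * ((a⁻¹ : Matrix.unitaryGroup (Fin n ⊕ Fin n) ℂ) :
        Matrix (Fin n ⊕ Fin n) (Fin n ⊕ Fin n) ℂ) = 1 := by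
      have := congrArg (fun u : Matrix.unitaryGroup (Fin n ⊕ Fin n) ℂ =>
        (u : Matrix (Fin n ⊕ Fin n) (Fin n ⊕ Fin n) ℂ)) (mul_inv_cancel a)
      simpa using this -- coercion cleanup
    calc ((a⁻¹ : Matrix.unitaryGroup _ ℂ) : Matrix _ _ ℂ)ᵀ * Jmat n *
          ((a⁻¹ : Matrix.unitaryGroup _ ℂ) : Matrix _ _ ℂ)
        = ((a⁻¹ : Matrix.unitaryGroup _ ℂ) : Matrix _ _ ℂ)ᵀ *
            ((a : Matrix _ _ ℂ)ᵀ * Jmat n * (a : Matrix _ _ ℂ)) *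
            ((a⁻¹ : Matrix.unitaryGroup _ ℂ) : Matrix _ _ ℂ) := by rw [ha]
      _ = ((a : Matrix _ _ ℂ) * ((a⁻¹ : Matrix.unitaryGroup _ ℂ) : Matrix _ _ ℂ))ᵀ * Jmat n *
            ((a : Matrix _ _ ℂ) * ((a⁻¹ : Matrix.unitaryGroup _ ℂ) : Matrix _ _ ℂ)) := by
          rw [transpose_mul]; simp only [Matrix.mul_assoc]
      _ = Jmat n := by rw [h2]; simp

variable {n : ℕ}

private lemma map_conj_eq (U : Matrix (Fin n) (Fin n) ℂ) :
    U.map (starRingEnd ℂ) = (Uᴴ)ᵀ := by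
  ext i j
  simp [Matrix.map_apply, conjTranspose_apply]

private lemma conjTranspose_map_conj (U : Matrix (Fin n) (Fin n) ℂ) :
    (U.map (starRingEnd ℂ))ᴴ = Uᵀ := by
  ext i j
  simp [Matrix.map_apply, conjTranspose_apply]

/-- The embedding `U ↦ diag(U, conj U)` of `SU(n)` into the compact symplectic group
`Sp(2n)`. -/
def suToSp (n : ℕ) (A : ↥(SU n)) : ↥(Sp n) := by
  refine ⟨⟨fromBlocks A.1.1 0 0 (A.1.1.map (starRingEnd ℂ)), ?_, ?_⟩, ?_⟩
  · -- star g * g = 1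
    have h1 : star A.1.1 * A.1.1 = 1 := A.1.2.1
    rw [Matrix.star_eq_conjTranspose, fromBlocks_conjTranspose, fromBlocks_multiply]
    rw [conjTranspose_map_conj]
    have h2 : (A.1.1)ᵀ * A.1.1.map (starRingEnd ℂ) = 1 := by
      rw [map_conj_eq, ← transpose_mul, ← Matrix.star_eq_conjTranspose, h1, transpose_one]
    simp [← Matrix.star_eq_conjTranspose, h1, h2, fromBlocks_one]
  · -- g * star g = 1
    have h1 : A.1.1 * star A.1.1 = 1 := A.1.2.2
    rw [Matrix.star_eq_conjTranspose, fromBlocks_conjTranspose, fromBlocks_multiply]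
    rw [conjTranspose_map_conj]
    have h2 : A.1.1.map (starRingEnd ℂ) * (A.1.1)ᵀ = 1 := by
      rw [map_conj_eq, ← transpose_mul, ← Matrix.star_eq_conjTranspose, h1, transpose_one]
    simp [← Matrix.star_eq_conjTranspose, h1, h2, fromBlocks_one]
  · -- symplectic condition
    show (fromBlocks A.1.1 0 0 (A.1.1.map (starRingEnd ℂ)))ᵀ * Jmat n *
      fromBlocks A.1.1 0 0 (A.1.1.map (starRingEnd ℂ)) = Jmat n
    have h1 : star A.1.1 * A.1.1 = 1 := A.1.2.1
    have hUV : (A.1.1)ᵀ * A.1.1.map (starRingEnd ℂ) = 1 := by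
      rw [map_conj_eq, ← transpose_mul, ← Matrix.star_eq_conjTranspose, h1, transpose_one]
    have hVU : (A.1.1.map (starRingEnd ℂ))ᵀ * A.1.1 = 1 := by
      have : (A.1.1.map (starRingEnd ℂ))ᵀ = star A.1.1 := by
        rw [map_conj_eq, transpose_transpose, Matrix.star_eq_conjTranspose]
      rw [this, h1]
    rw [fromBlocks_transpose, Jmat, fromBlocks_multiply, fromBlocks_multiply]
    simp [hUV, hVU]

private lemma continuous_entries : Continuous fun A : ↥(SU n) =>
    ((A : Matrix.unitaryGroup (Fin n) ℂ) : Matrix (Fin n) (Fin n) ℂ) :=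
  continuous_subtype_val.comp continuous_subtype_val

lemma continuous_suToSp (n : ℕ) : Continuous (suToSp n) := by
  apply Continuous.subtype_mk
  apply Continuous.subtype_mk
  apply continuous_matrix
  intro i j
  rcases i with i | i <;> rcases j with j | j <;>
    simp only [fromBlocks_apply₁₁, fromBlocks_apply₁₂, fromBlocks_apply₂₁, fromBlocks_apply₂₂,
      Matrix.zero_apply, Matrix.map_apply]
  · exact continuous_entries.matrix_elem i j
  · exact continuous_const
  · exact continuous_const
  · exact continuous_star.comp (continuous_entries.matrix_elem i j)

/-- The embedding `U ↦ diag(U, conj U)` of `SU(n)` into `Sp(2n)` as a continuous map. -/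
def spEmbedding (n : ℕ) : C(↥(SU n), ↥(Sp n)) :=
  ⟨suToSp n, continuous_suToSp n⟩

lemma spEmbedding_one (n : ℕ) : spEmbedding n 1 = 1 := by
  apply Subtype.ext
  apply Subtype.ext
  show fromBlocks (1 : Matrix (Fin n) (Fin n) ℂ) 0 0 ((1 : Matrix (Fin n) (Fin n) ℂ).map
    (starRingEnd ℂ)) = 1
  have : (1 : Matrix (Fin n) (Fin n) ℂ).map (starRingEnd ℂ) = 1 := by
    ext i j
    by_cases h : i = j <;> simp [Matrix.map_apply, Matrix.one_apply, h]
  rw [this, fromBlocks_one]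

/-- The map on homotopy groups induced by a pointed continuous map. -/
def HomotopyGroup.induced {X Y : Type*} [TopologicalSpace X] [TopologicalSpace Y]
    (N : Type*) (f : C(X, Y)) {x : X} {y : Y} (hf : f x = y) :
    HomotopyGroup N X x → HomotopyGroup N Y y :=
  Quotient.map
    (fun g => ⟨f.comp g.1, fun z hz => by
      simp only [ContinuousMap.comp_apply]
      rw [g.2 z hz, hf]⟩)
    (fun a b hab => hab.map fun H => H.compContinuousMap f)

section Loops

open unitInterval

variable {ι X Y : Type*} [TopologicalSpace X] [TopologicalSpace Y]

lemma GenLoop.homotopic_of_family {x : X} {f g : Ω^ ι X x} (F : C(I × (ι → I), X))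
    (h0 : ∀ y, F (0, y) = f y) (h1 : ∀ y, F (1, y) = g y)
    (hb : ∀ u, ∀ y ∈ Cube.boundary ι, F (u, y) = x) : GenLoop.Homotopic f g :=
  ⟨{ toContinuousMap := F
     map_zero_left := h0
     map_one_left := h1
     prop' := fun u y hy => (hb u y hy).trans (f.2 y hy).symm }⟩

/-- Postcomposition of a generalized loop with a pointed continuous map. -/
def GenLoop.map {x : X} {y : Y} (φ : C(X, Y)) (h : φ x = y) (f : Ω^ ι X x) : Ω^ ι Y y :=
  ⟨φ.comp f.1, fun z hz => by
    rw [ContinuousMap.comp_apply, f.2 z hz, h]⟩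

lemma GenLoop.map_apply {x : X} {y : Y} (φ : C(X, Y)) (h : φ x = y) (f : Ω^ ι X x) (t : ι → I) :
    GenLoop.map φ h f t = φ (f t) := rfl

lemma GenLoop.Homotopic.map {x : X} {y : Y} (φ : C(X, Y)) (h : φ x = y) {f g : Ω^ ι X x}
    (H : GenLoop.Homotopic f g) : GenLoop.Homotopic (GenLoop.map φ h f) (GenLoop.map φ h g) :=
  ContinuousMap.HomotopicRel.comp_continuousMap H φ

/-- Pointwise product of generalized loops in a topological group. -/
def GenLoop.pointwiseMul {G : Type*} [TopologicalSpace G] [Group G] [IsTopologicalGroup G]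
    (f g : Ω^ ι G 1) : Ω^ ι G 1 :=
  ⟨⟨fun t => f t * g t, f.1.continuous.mul g.1.continuous⟩, fun t ht => by
    change f t * g t = 1
    rw [GenLoop.boundary f t ht, GenLoop.boundary g t ht, one_mul]⟩

lemma GenLoop.pointwiseMul_apply {G : Type*} [TopologicalSpace G] [Group G] [IsTopologicalGroup G]
    (f g : Ω^ ι G 1) (t : ι → I) : GenLoop.pointwiseMul f g t = f t * g t := rfl

lemma GenLoop.Homotopic.pointwiseMul {G : Type*} [TopologicalSpace G] [Group G]
    [IsTopologicalGroup G] {f f' g g' : Ω^ ι G 1} (hf : GenLoop.Homotopic f f')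
    (hg : GenLoop.Homotopic g g') :
    GenLoop.Homotopic (GenLoop.pointwiseMul f g) (GenLoop.pointwiseMul f' g') := by
  obtain ⟨F⟩ := hf
  obtain ⟨K⟩ := hg
  refine GenLoop.homotopic_of_family ⟨fun p => F p * K p, F.continuous.mul K.continuous⟩
    (fun y => ?_) (fun y => ?_) (fun u y hy => ?_)
  · change F (0, y) * K (0, y) = f y * g y
    rw [F.apply_zero, K.apply_zero]; rfl
  · change F (1, y) * K (1, y) = f' y * g' y
    rw [F.apply_one, K.apply_one]; rfl
  · change F (u, y) * K (u, y) = 1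
    rw [F.eq_fst u hy, K.eq_fst u hy, f.2 y hy, g.2 y hy, one_mul]

/-- The class of a generalized loop in the homotopy group. -/
def HomotopyGroup.mk {x : X} (f : Ω^ ι X x) : HomotopyGroup ι X x :=
  Quotient.mk _ f

lemma HomotopyGroup.mk_eq_iff {x : X} {f g : Ω^ ι X x} :
    HomotopyGroup.mk f = HomotopyGroup.mk g ↔ GenLoop.Homotopic f g :=
  Quotient.eq

/-- Concatenation of generalized loops in a topological group agrees with the pointwise product. -/
lemma HomotopyGroup.mk_pointwiseMul [DecidableEq ι] [Nonempty ι] {G : Type*} [TopologicalSpace G]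
    [Group G] [IsTopologicalGroup G] (f g : Ω^ ι G 1) :
    HomotopyGroup.mk (GenLoop.pointwiseMul f g) = HomotopyGroup.mk f * HomotopyGroup.mk g := by
  let i : ι := Classical.arbitrary ι
  have h1 (a b : Ω^ ι G 1) : HomotopyGroup.mk a * HomotopyGroup.mk b =
      HomotopyGroup.mk (GenLoop.transAt i b a) := HomotopyGroup.mul_spec
  have hf : GenLoop.Homotopic (GenLoop.transAt i GenLoop.const f) f := by
    rw [← HomotopyGroup.mk_eq_iff, ← h1]
    exact mul_one _
  have hg : GenLoop.Homotopic (GenLoop.transAt i g GenLoop.const) g := by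
    rw [← HomotopyGroup.mk_eq_iff, ← h1]
    exact one_mul _
  rw [h1, ← HomotopyGroup.mk_eq_iff.2 (hf.pointwiseMul hg)]
  congr 1
  ext t
  rw [GenLoop.pointwiseMul_apply]
  simp only [GenLoop.transAt, GenLoop.coe_copy]
  split_ifs <;> simp

end Loops

section SphereMaps

open unitInterval

variable {E : Type*} [NormedAddCommGroup E] [NormedSpace ℝ E]

/-- The point at time `u` of the segment from `x` to `y`, projected radially to the unit sphere. -/
def sphereSegment (x y : E) (u : ℝ) : E :=
  ‖(1 - u) • x + u • y‖⁻¹ • ((1 - u) • x + u • y)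

lemma segment_ne_zero {x y : E} (hx : ‖x‖ = 1) (hy : ‖y‖ = 1) (hxy : x ≠ -y) {u : ℝ}
    (h0 : 0 ≤ u) (h1 : u ≤ 1) : (1 - u) • x + u • y ≠ 0 := by
  intro h
  have h2 : (1 - u) • x = -(u • y) := eq_neg_of_add_eq_zero_left h
  have h3 := congrArg norm h2
  rw [norm_neg, norm_smul, norm_smul, hx, hy, Real.norm_of_nonneg h0,
    Real.norm_of_nonneg (by linarith)] at h3
  have h4 : u = 1 / 2 := by linarith
  apply hxy
  rw [h4] at h2
  norm_num at h2
  have h5 : (1 / 2 : ℝ) • x = (1 / 2 : ℝ) • (-y) := by simpa using h2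
  exact smul_right_injective E (by norm_num : (1 / 2 : ℝ) ≠ 0) h5

lemma norm_sphereSegment {x y : E} (hx : ‖x‖ = 1) (hy : ‖y‖ = 1) (hxy : x ≠ -y) {u : ℝ}
    (h0 : 0 ≤ u) (h1 : u ≤ 1) : ‖sphereSegment x y u‖ = 1 := by
  rw [sphereSegment, norm_smul, norm_inv, norm_norm]
  exact inv_mul_cancel₀ (norm_ne_zero_iff.2 (segment_ne_zero hx hy hxy h0 h1))

lemma sphereSegment_zero {x : E} (y : E) (hx : ‖x‖ = 1) : sphereSegment x y 0 = x := by
  simp [sphereSegment, hx]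

lemma sphereSegment_one (x : E) {y : E} (hy : ‖y‖ = 1) : sphereSegment x y 1 = y := by
  simp [sphereSegment, hy]

lemma sphereSegment_self {x : E} (hx : ‖x‖ = 1) (u : ℝ) : sphereSegment x x u = x := by
  have : (1 - u) • x + u • x = x := by rw [← add_smul]; simp
  simp [sphereSegment, this, hx]

lemma sphereSegment_ne_neg_right {x y : E} (hx : ‖x‖ = 1) (hy : ‖y‖ = 1) (hxy : x ≠ -y) {u : ℝ}
    (h0 : 0 ≤ u) (h1 : u ≤ 1) : sphereSegment x y u ≠ -y := by
  intro h
  set r := ‖(1 - u) • x + u • y‖ with hr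
  have hr0 : 0 < r := norm_pos_iff.2 (segment_ne_zero hx hy hxy h0 h1)
  have h2 : (1 - u) • x + u • y = -(r • y) := by
    have := congrArg (fun z => r • z) h
    simpa [sphereSegment, ← hr, smul_smul, hr0.ne'] using this
  have h3 : (1 - u) • x = (r + u) • (-y) := by
    rw [smul_neg, add_smul, neg_add, ← h2]; abel
  have h4 := congrArg norm h3
  rw [norm_smul, norm_smul, norm_neg, hx, hy, Real.norm_of_nonneg (by linarith),
    Real.norm_of_nonneg (by linarith)] at h4
  have h5 : r + u ≠ 0 := by linarith
  rw [show 1 - u = r + u by linarith] at h3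
  exact hxy (smul_right_injective E h5 h3)

lemma sphereSegment_ne_neg_left {x y : E} (hx : ‖x‖ = 1) (hy : ‖y‖ = 1) (hxy : x ≠ -y) {u : ℝ}
    (h0 : 0 ≤ u) (h1 : u ≤ 1) : sphereSegment x y u ≠ -x := by
  have h : sphereSegment x y u = sphereSegment y x (1 - u) := by
    simp only [sphereSegment, sub_sub_cancel, add_comm]
  rw [h]
  exact sphereSegment_ne_neg_right hy hx (fun h => hxy (by rw [h, neg_neg])) (by linarith)
    (by linarith)

lemma continuous_sphereSegment {T : Type*} [TopologicalSpace T] {a b : T → E} {u : T → ℝ}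
    (ha : Continuous a) (hb : Continuous b) (hu : Continuous u) (ha1 : ∀ t, ‖a t‖ = 1)
    (hb1 : ∀ t, ‖b t‖ = 1) (hab : ∀ t, a t ≠ -b t) (h0 : ∀ t, 0 ≤ u t) (h1 : ∀ t, u t ≤ 1) :
    Continuous fun t => sphereSegment (a t) (b t) (u t) := by
  have hc : Continuous fun t => (1 - u t) • a t + u t • b t := by fun_prop
  exact (hc.norm.inv₀ fun t => norm_ne_zero_iff.2
    (segment_ne_zero (ha1 t) (hb1 t) (hab t) (h0 t) (h1 t))).smul hc

/-- A map from a cube to a unit sphere of larger dimension can be moved, without passing through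
antipodes and keeping it constant where it takes the value `e`, to a map missing a point. -/
lemma exists_sphere_map_missing_point {ι : Type*} [Fintype ι] [FiniteDimensional ℝ E]
    (hE : Fintype.card ι + 1 < Module.finrank ℝ E) {v : (ι → I) → E} (hv : Continuous v)
    (hv1 : ∀ t, ‖v t‖ = 1) {e : E} {t₀ : ι → I} (ht₀ : v t₀ = e) :
    ∃ (w : (ι → I) → E) (q : E), Continuous w ∧ (∀ t, ‖w t‖ = 1) ∧ (∀ t, v t = e → w t = e) ∧
      (∀ t, v t ≠ -w t) ∧ ‖q‖ = 1 ∧ e ≠ -q ∧ ∀ t, w t ≠ -q := by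
  have he : ‖e‖ = 1 := ht₀ ▸ hv1 t₀
  let pr : (ι → ℝ) → (ι → I) := fun x i => Set.projIcc 0 1 zero_le_one (x i)
  have hpr : Continuous pr := continuous_pi fun i => continuous_projIcc.comp (continuous_apply i)
  have hpr' (t : ι → I) : pr (fun i => t i) = t := by
    funext i
    simp [pr]
  obtain ⟨g₀, hg₀, hg₀d, hg₀s⟩ := Continuous.exists_contDiff_approx (f := fun x => v (pr x) - e)
    (ε := fun _ => 1) 1 (by fun_prop) continuous_const (fun _ => one_pos)
  let g : (ι → ℝ) → E := fun x => g₀ x + e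
  have hg : ContDiff ℝ 1 g := hg₀.add contDiff_const
  have hgd (t : ι → I) : ‖g (fun i => t i) - v t‖ < 1 := by
    have := hg₀d (fun i => t i)
    rw [dist_eq_norm, hpr'] at this
    convert! this using 2
    simp only [g]
    abel
  have hge (t : ι → I) (ht : v t = e) : g (fun i => t i) = e := by
    have : g₀ (fun i => t i) = 0 := by
      by_contra hne
      have := hg₀s (Function.mem_support.2 hne)
      simp [hpr', ht] at this
    simp [g, this]
  have hg0 (t : ι → I) : g (fun i => t i) ≠ 0 := by
    intro h
    have := hgd t
    rw [h, zero_sub, norm_neg, hv1] at this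
    exact lt_irrefl _ this
  have hcone : ContDiff ℝ 1 fun p : ℝ × (ι → ℝ) => p.1 • g p.2 :=
    contDiff_fst.smul (hg.comp contDiff_snd)
  have hdense := hcone.dense_compl_range_of_finrank_lt_finrank (by simpa [add_comm] using hE)
  obtain ⟨p, hp⟩ := hdense.nonempty
  have hp' (r : ℝ) (t : ι → I) : r • g (fun i => t i) ≠ p := fun h => hp ⟨(r, fun i => t i), h⟩
  have hp0 : p ≠ 0 := fun h => hp' 0 t₀ (by rw [zero_smul, h])
  let w : (ι → I) → E := fun t => ‖g (fun i => t i)‖⁻¹ • g (fun i => t i)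
  have hwq (t : ι → I) : w t ≠ -(-(‖p‖⁻¹ • p)) := by
    intro h
    rw [neg_neg] at h
    apply hp' (‖p‖ * ‖g (fun i => t i)‖⁻¹) t
    rw [mul_smul]
    change ‖p‖ • w t = p
    rw [h, smul_smul, mul_inv_cancel₀ (norm_ne_zero_iff.2 hp0), one_smul]
  have hwe (t : ι → I) (ht : v t = e) : w t = e := by simp [w, hge t ht, he]
  have hgI : Continuous fun t : ι → I => g (fun i => t i) := hg.continuous.comp (by fun_prop)
  refine ⟨w, -(‖p‖⁻¹ • p), ?_, ?_, hwe, ?_, ?_, ?_, hwq⟩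
  · exact (hgI.norm.inv₀ fun t => norm_ne_zero_iff.2 (hg0 t)).smul hgI
  · intro t
    simp only [w]
    rw [norm_smul, norm_inv, norm_norm, inv_mul_cancel₀ (norm_ne_zero_iff.2 (hg0 t))]
  · intro t h
    have hpos : 0 < ‖g (fun i => t i)‖ := norm_pos_iff.2 (hg0 t)
    have h2 : g (fun i => t i) = -(‖g (fun i => t i)‖ • v t) := by
      rw [h, smul_neg, neg_neg, smul_smul, mul_inv_cancel₀ hpos.ne', one_smul]
    have h3 := hgd t
    have h4 : g (fun i => t i) - v t = (-(‖g (fun i => t i)‖ + 1)) • v t := by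
      rw [neg_smul, add_smul, one_smul, neg_add, ← h2, sub_eq_add_neg]
    rw [h4, norm_smul, hv1, norm_neg, Real.norm_of_nonneg (by linarith)] at h3
    linarith
  · rw [norm_neg, norm_smul, norm_inv, norm_norm, inv_mul_cancel₀ (norm_ne_zero_iff.2 hp0)]
  · exact hwe t₀ ht₀ ▸ hwq t₀

end SphereMaps

section Deformation

open unitInterval

lemma Topology.IsInducing.exists_continuousOn_lift {P G X : Type*} [TopologicalSpace P]
    [TopologicalSpace G] [TopologicalSpace X] [Nonempty G] {i : G → X}
    (hi : Topology.IsInducing i) {M : P → X} {D : Set P} (hM : ContinuousOn M D)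
    (h : ∀ p ∈ D, M p ∈ Set.range i) :
    ∃ R : P → G, ContinuousOn R D ∧ ∀ p ∈ D, i (R p) = M p := by
  classical
  choose! R hR using h
  exact ⟨R, hi.continuousOn_iff.2 (hM.congr hR), hR⟩

/-- Suppose `col` maps a subgroup `K` of a topological group to the unit sphere of a vector space
of dimension larger than that of the cube plus one, and `R v w ∈ K` moves `w` to `v` continuously
in `v ≠ -w`. Then every loop in `K` can be deformed to one with constant image under `col`. -/
lemma exists_homotopic_constant_col {ι E G : Type*} [Fintype ι] [Nonempty ι]
    [NormedAddCommGroup E] [NormedSpace ℝ E] [FiniteDimensional ℝ E]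
    (hE : Fintype.card ι + 1 < Module.finrank ℝ E)
    [TopologicalSpace G] [Group G] [IsTopologicalGroup G] (K : Subgroup G) {col : G → E}
    (hcol : Continuous col) (hnorm : ∀ g ∈ K, ‖col g‖ = 1) (R : E × E → G)
    (hR : ContinuousOn R {p | ‖p.1‖ = 1 ∧ ‖p.2‖ = 1 ∧ p.1 ≠ -p.2})
    (hRK : ∀ v w, ‖v‖ = 1 → ‖w‖ = 1 → v ≠ -w → R (v, w) ∈ K)
    (hRcol : ∀ v w, ‖v‖ = 1 → ‖w‖ = 1 → v ≠ -w → ∀ g ∈ K, col g = w → col (R (v, w) * g) = v)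
    (hRcol' : ∀ v w, ‖v‖ = 1 → ‖w‖ = 1 → v ≠ -w → ∀ g ∈ K, col g = v →
      col ((R (v, w))⁻¹ * g) = w)
    (f : Ω^ ι G 1) (hf : ∀ t, f t ∈ K) :
    ∃ g : Ω^ ι G 1, GenLoop.Homotopic f g ∧ ∀ t, g t ∈ K ∧ col (g t) = col 1 := by
  set e := col 1 with he
  have he1 : ‖e‖ = 1 := hnorm 1 K.one_mem
  have hne {x : E} (hx : ‖x‖ = 1) : x ≠ -x := by
    intro h
    have h2 : (2 : ℝ) • x = 0 := by rw [two_smul]; exact add_eq_zero_iff_eq_neg.2 h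
    have h0 : x = 0 := (smul_eq_zero.1 h2).resolve_left two_ne_zero
    simp [h0] at hx
  let v : (ι → I) → E := fun t => col (f t)
  have hv : Continuous v := hcol.comp f.1.continuous
  have hv1 (t) : ‖v t‖ = 1 := hnorm _ (hf t)
  have hve (t) (ht : t ∈ Cube.boundary ι) : v t = e := by
    simp only [v, GenLoop.boundary f t ht, he]
  have ht₀ : (0 : ι → I) ∈ Cube.boundary ι := ⟨Classical.arbitrary ι, Or.inl rfl⟩
  obtain ⟨w, q, hw, hw1, hwe, hvw, hq, heq, hwq⟩ :=
    exists_sphere_map_missing_point hE hv hv1 (hve 0 ht₀)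
  have hwv (t) : w t ≠ -v t := fun h => hvw t (by rw [h, neg_neg])
  -- First move the image of the loop to `w`.
  let F₁ : C(I × (ι → I), G) :=
    ⟨fun p => R (sphereSegment (v p.2) (w p.2) p.1, v p.2) * (R (v p.2, v p.2))⁻¹ * f p.2, by
      refine Continuous.mul (Continuous.mul ?_ (Continuous.inv ?_))
        (f.1.continuous.comp continuous_snd)
      · refine hR.comp_continuous (Continuous.prodMk (continuous_sphereSegment
          (hv.comp continuous_snd) (hw.comp continuous_snd) (by fun_prop) (fun p => hv1 _)
          (fun p => hw1 _) (fun p => hvw _) (fun p => p.1.2.1) (fun p => p.1.2.2))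
          (hv.comp continuous_snd)) fun p => ?_
        exact ⟨norm_sphereSegment (hv1 _) (hw1 _) (hvw _) p.1.2.1 p.1.2.2, hv1 _,
          sphereSegment_ne_neg_left (hv1 _) (hw1 _) (hvw _) p.1.2.1 p.1.2.2⟩
      · exact hR.comp_continuous (by fun_prop) fun p => ⟨hv1 _, hv1 _, hne (hv1 _)⟩⟩
  have hF₁b (u : I) (y) (hy : y ∈ Cube.boundary ι) : F₁ (u, y) = 1 := by
    change R (sphereSegment (v y) (w y) u, v y) * (R (v y, v y))⁻¹ * f y = 1
    rw [GenLoop.boundary f y hy, hwe y (hve y hy), hve y hy, sphereSegment_self he1]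
    simp
  let f' : Ω^ ι G 1 := ⟨⟨fun y => F₁ (1, y), by fun_prop⟩, fun y hy => hF₁b 1 y hy⟩
  have hf' (y) : f' y = R (w y, v y) * ((R (v y, v y))⁻¹ * f y) := by
    change R (sphereSegment (v y) (w y) (1 : ℝ), v y) * (R (v y, v y))⁻¹ * f y = _
    rw [sphereSegment_one _ (hw1 y), mul_assoc]
  have hff' : GenLoop.Homotopic f f' := by
    refine GenLoop.homotopic_of_family F₁ (fun y => ?_) (fun y => rfl) hF₁b
    change R (sphereSegment (v y) (w y) (0 : ℝ), v y) * (R (v y, v y))⁻¹ * f y = _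
    rw [sphereSegment_zero _ (hv1 y)]
    simp
  have hf'K (y) : f' y ∈ K := by
    rw [hf']
    exact K.mul_mem (hRK _ _ (hw1 y) (hv1 y) (hwv y)) (K.mul_mem (K.inv_mem
      (hRK _ _ (hv1 y) (hv1 y) (hne (hv1 y)))) (hf y))
  have hf'col (y) : col (f' y) = w y := by
    rw [hf']
    exact hRcol _ _ (hw1 y) (hv1 y) (hwv y) _ (K.mul_mem (K.inv_mem
      (hRK _ _ (hv1 y) (hv1 y) (hne (hv1 y)))) (hf y))
      (hRcol' _ _ (hv1 y) (hv1 y) (hne (hv1 y)) _ (hf y) rfl)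
  -- Then contract the complement of the missing point `-q`.
  have hseg {T : Type _} [TopologicalSpace T] {a : T → E} {u : T → I} (ha : Continuous a)
      (hu : Continuous u) (ha1 : ∀ t, ‖a t‖ = 1) (haq : ∀ t, a t ≠ -q) :
      Continuous fun t => R (sphereSegment (a t) q (u t), q) := by
    refine hR.comp_continuous (Continuous.prodMk (continuous_sphereSegment ha continuous_const
      (by fun_prop) ha1 (fun _ => hq) haq (fun t => (u t).2.1) (fun t => (u t).2.2))
      continuous_const) fun t => ?_
    exact ⟨norm_sphereSegment (ha1 _) hq (haq _) (u t).2.1 (u t).2.2, hq,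
      sphereSegment_ne_neg_right (ha1 _) hq (haq _) (u t).2.1 (u t).2.2⟩
  have hgc : Continuous fun y => R (e, q) * ((R (w y, q))⁻¹ * f' y) := by
    refine continuous_const.mul (Continuous.mul (Continuous.inv ?_) f'.1.continuous)
    exact hR.comp_continuous (by fun_prop) fun y => ⟨hw1 y, hq, hwq y⟩
  let g : Ω^ ι G 1 := ⟨⟨_, hgc⟩, fun y hy => by
    change R (e, q) * ((R (w y, q))⁻¹ * f' y) = 1
    rw [GenLoop.boundary f' y hy, hwe y (hve y hy)]
    simp⟩
  have hg (y) : g y = R (e, q) * ((R (w y, q))⁻¹ * f' y) := rfl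
  refine ⟨g, hff'.trans ?_, fun y => ⟨?_, ?_⟩⟩
  · refine GenLoop.homotopic_of_family ⟨fun p => R (sphereSegment (w p.2) q p.1, q) *
      (R (sphereSegment e q p.1, q))⁻¹ * g p.2, ?_⟩ (fun y => ?_) (fun y => ?_) (fun u y hy => ?_)
    · exact ((hseg (hw.comp continuous_snd) continuous_fst (fun p => hw1 _)
        (fun p => hwq _)).mul (hseg continuous_const continuous_fst (fun p => he1)
        (fun p => heq)).inv).mul (g.1.continuous.comp continuous_snd)
    · change R (sphereSegment (w y) q (0 : ℝ), q) * (R (sphereSegment e q (0 : ℝ), q))⁻¹ * g y = _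
      rw [sphereSegment_zero _ (hw1 y), sphereSegment_zero _ he1, hg]
      group
    · change R (sphereSegment (w y) q (1 : ℝ), q) * (R (sphereSegment e q (1 : ℝ), q))⁻¹ * g y = _
      rw [sphereSegment_one _ hq, sphereSegment_one _ hq]
      group
    · change R (sphereSegment (w y) q u, q) * (R (sphereSegment e q u, q))⁻¹ * g y = _
      rw [hwe y (hve y hy), GenLoop.boundary g y hy]
      group
  · rw [hg]
    exact K.mul_mem (hRK _ _ he1 hq heq) (K.mul_mem (K.inv_mem (hRK _ _ (hw1 y) hq (hwq y)))
      (hf'K y))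
  · rw [hg]
    exact hRcol _ _ he1 hq heq _ (K.mul_mem (K.inv_mem (hRK _ _ (hw1 y) hq (hwq y)))
      (hf'K y)) (hRcol' _ _ (hw1 y) hq (hwq y) _ (hf'K y) (hf'col y))

end Deformation

section Frames

variable {m κ τ : Type*} [Fintype m] [Fintype κ] [DecidableEq κ]

lemma isUnit_det_one_add_self {W : Matrix m κ ℂ} (hW : Wᴴ * W = 1) :
    IsUnit (1 + Wᴴ * W).det := by
  have : (1 + Wᴴ * W) = (2 : ℂ) • (1 : Matrix κ κ ℂ) := by rw [hW, two_smul]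
  rw [this, det_smul, det_one, mul_one]
  exact (pow_ne_zero _ two_ne_zero).isUnit

variable [DecidableEq m]

/-- For frames `V` and `W` with `1 + Vᴴ W` invertible, a unitary matrix that maps `W` to `V` and is
`-1` on the orthogonal complement of both. -/
def frameReflection (V W : Matrix m κ ℂ) : Matrix m m ℂ :=
  (V + W) * (1 + Vᴴ * W)⁻¹ * (V + W)ᴴ - 1

/-- For frames `V` and `W` with `1 + Vᴴ W` invertible, a unitary matrix that maps `W` to `V` and is
the identity on the orthogonal complement of both. -/
def frameRotation (V W : Matrix m κ ℂ) : Matrix m m ℂ :=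
  frameReflection V W * frameReflection W W

lemma frameReflection_mul {V W : Matrix m κ ℂ} (hW : Wᴴ * W = 1)
    (hA : IsUnit (1 + Vᴴ * W).det) : frameReflection V W * W = V := by
  have h : (V + W)ᴴ * W = 1 + Vᴴ * W := by
    rw [conjTranspose_add, Matrix.add_mul, hW, add_comm]
  rw [frameReflection, Matrix.sub_mul, Matrix.one_mul, Matrix.mul_assoc, h, Matrix.mul_assoc,
    nonsing_inv_mul _ hA, Matrix.mul_one, add_sub_cancel_right]

lemma frameReflection_conjTranspose_mul_self {V W : Matrix m κ ℂ} (hV : Vᴴ * V = 1)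
    (hW : Wᴴ * W = 1) (hA : IsUnit (1 + Vᴴ * W).det) :
    (frameReflection V W)ᴴ * frameReflection V W = 1 := by
  rw [frameReflection]
  generalize hS : V + W = S
  generalize hA' : 1 + Vᴴ * W = A at hA
  have hSS : Sᴴ * S = A + Aᴴ := by
    rw [← hS, ← hA', conjTranspose_add, conjTranspose_add, conjTranspose_mul,
      conjTranspose_conjTranspose, conjTranspose_one, Matrix.add_mul, Matrix.mul_add,
      Matrix.mul_add, hV, hW]
    abel
  have h1 : A * A⁻¹ = 1 := mul_nonsing_inv _ hA
  have h2 : (A⁻¹)ᴴ * Aᴴ = 1 := by rw [← conjTranspose_mul, h1, conjTranspose_one]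
  generalize A⁻¹ = B at h1 h2
  have h3 : Bᴴ * (Sᴴ * S) * B = B + Bᴴ := by
    rw [hSS, Matrix.mul_add, Matrix.add_mul, h2, Matrix.mul_assoc, h1, Matrix.one_mul,
      Matrix.mul_one, add_comm]
  have h4 : S * Bᴴ * Sᴴ * (S * B * Sᴴ) = S * B * Sᴴ + S * Bᴴ * Sᴴ := by
    calc S * Bᴴ * Sᴴ * (S * B * Sᴴ) = S * (Bᴴ * (Sᴴ * S) * B) * Sᴴ := by
          simp only [Matrix.mul_assoc]
      _ = _ := by rw [h3, Matrix.mul_add, Matrix.add_mul]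
  rw [conjTranspose_sub, conjTranspose_mul, conjTranspose_mul, conjTranspose_conjTranspose,
    conjTranspose_one, ← Matrix.mul_assoc, Matrix.sub_mul, Matrix.mul_sub, h4]
  simp

lemma frameReflection_mul_of_orthogonal {V W : Matrix m κ ℂ} {X : Matrix m τ ℂ}
    (hV : Vᴴ * X = 0) (hW : Wᴴ * X = 0) : frameReflection V W * X = -X := by
  have h : (V + W)ᴴ * X = 0 := by rw [conjTranspose_add, Matrix.add_mul, hV, hW, add_zero]
  rw [frameReflection, Matrix.sub_mul, Matrix.mul_assoc, h, Matrix.mul_zero, Matrix.one_mul,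
    zero_sub]

lemma frameRotation_mul {V W : Matrix m κ ℂ} (hW : Wᴴ * W = 1)
    (hA : IsUnit (1 + Vᴴ * W).det) : frameRotation V W * W = V := by
  rw [frameRotation, Matrix.mul_assoc, frameReflection_mul hW (isUnit_det_one_add_self hW),
    frameReflection_mul hW hA]

lemma frameRotation_conjTranspose_mul_self {V W : Matrix m κ ℂ} (hV : Vᴴ * V = 1)
    (hW : Wᴴ * W = 1) (hA : IsUnit (1 + Vᴴ * W).det) :
    (frameRotation V W)ᴴ * frameRotation V W = 1 := by
  rw [frameRotation, conjTranspose_mul, Matrix.mul_assoc,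
    ← Matrix.mul_assoc _ (frameReflection V W),
    frameReflection_conjTranspose_mul_self hV hW hA, Matrix.one_mul,
    frameReflection_conjTranspose_mul_self hW hW (isUnit_det_one_add_self hW)]

lemma frameRotation_mul_of_orthogonal {V W : Matrix m κ ℂ} {X : Matrix m τ ℂ}
    (hV : Vᴴ * X = 0) (hW : Wᴴ * X = 0) : frameRotation V W * X = X := by
  rw [frameRotation, Matrix.mul_assoc, frameReflection_mul_of_orthogonal hW hW, Matrix.mul_neg,
    frameReflection_mul_of_orthogonal hV hW, neg_neg]

lemma continuousOn_frameReflection {T : Type*} [TopologicalSpace T] {V W : T → Matrix m κ ℂ}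
    {D : Set T} (hV : ContinuousOn V D) (hW : ContinuousOn W D)
    (hA : ∀ t ∈ D, IsUnit (1 + (V t)ᴴ * W t).det) :
    ContinuousOn (fun t => frameReflection (V t) (W t)) D := by
  have hc : ContinuousOn (fun t => (1 + (V t)ᴴ * W t)⁻¹) D := by
    intro t ht
    have h1 : ContinuousAt Ring.inverse (1 + (V t)ᴴ * W t).det := by
      rw [Ring.inverse_eq_inv']
      exact continuousAt_inv₀ (hA t ht).ne_zero
    have h2 : ContinuousOn (fun t => 1 + (V t)ᴴ * W t) D := by
      rw [continuousOn_iff_continuous_domRestrict] at hV hW ⊢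
      exact continuous_const.add (hV.matrix_conjTranspose.matrix_mul hW)
    exact ContinuousAt.comp_continuousWithinAt (f := fun t => 1 + (V t)ᴴ * W t)
      (continuousAt_matrix_inv _ h1) (h2 t ht)
  rw [continuousOn_iff_continuous_domRestrict] at hV hW hc ⊢
  exact (((hV.add hW).matrix_mul hc).matrix_mul (hV.add hW).matrix_conjTranspose).sub
    continuous_const

lemma continuousOn_frameRotation {T : Type*} [TopologicalSpace T] {V W : T → Matrix m κ ℂ}
    {D : Set T} (hV : ContinuousOn V D) (hW : ContinuousOn W D) (hW1 : ∀ t ∈ D, (W t)ᴴ * W t = 1)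
    (hA : ∀ t ∈ D, IsUnit (1 + (V t)ᴴ * W t).det) :
    ContinuousOn (fun t => frameRotation (V t) (W t)) D :=
  (continuousOn_frameReflection hV hW hA).mul
    (continuousOn_frameReflection hW hW fun t ht => isUnit_det_one_add_self (hW1 t ht))

/-- Deforming loops in a group of unitary matrices fixing `X` to loops fixing one more frame. -/
lemma exists_homotopic_fixing_frame {ι E G : Type*} [Fintype ι] [Nonempty ι] [Nonempty κ]
    [NormedAddCommGroup E] [NormedSpace ℝ E] [FiniteDimensional ℝ E]
    (hE : Fintype.card ι + 1 < Module.finrank ℝ E)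
    [TopologicalSpace G] [Group G] [IsTopologicalGroup G] {i : G →* Matrix m m ℂ}
    (hi : Topology.IsInducing i) (hu : ∀ g, (i g)ᴴ * i g = 1)
    {F : E → Matrix m κ ℂ} (hF : Continuous F) (hFinj : Function.Injective F)
    (hFn : ∀ v, (F v)ᴴ * F v = ((‖v‖ ^ 2 : ℝ) : ℂ) • (1 : Matrix κ κ ℂ))
    (hFu : ∀ v w, ‖v‖ = 1 → ‖w‖ = 1 → v ≠ -w → IsUnit (1 + (F v)ᴴ * F w).det)
    (hFr : ∀ v w, ‖v‖ = 1 → ‖w‖ = 1 → v ≠ -w → frameRotation (F v) (F w) ∈ Set.range i)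
    (X : Matrix m τ ℂ) (hX : ∀ v, (F v)ᴴ * X = 0)
    {col : G → E} (hcol : Continuous col) (he : ‖col 1‖ = 1)
    (hcolF : ∀ g, i g * X = X → F (col g) = i g * F (col 1))
    (f : Ω^ ι G 1) (hf : ∀ t, i (f t) * X = X) :
    ∃ g : Ω^ ι G 1, GenLoop.Homotopic f g ∧
      ∀ t, i (g t) * X = X ∧ i (g t) * F (col 1) = F (col 1) := by
  have hinv (g : G) : i g⁻¹ * i g = 1 := by rw [← map_mul, inv_mul_cancel, map_one]
  have hF1 {v : E} (hv : ‖v‖ = 1) : (F v)ᴴ * F v = 1 := by simp [hFn, hv]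
  let K : Subgroup G :=
    { carrier := {g | i g * X = X}
      one_mem' := by
        change i 1 * X = X
        rw [map_one, Matrix.one_mul]
      mul_mem' := fun {a b} ha hb => by
        change i (a * b) * X = X
        rw [map_mul, Matrix.mul_assoc, hb, ha]
      inv_mem' := fun {a} ha => by
        change i a⁻¹ * X = X
        conv_lhs => rw [← ha]
        rw [← Matrix.mul_assoc, hinv, Matrix.one_mul] }
  have hK {g : G} : g ∈ K ↔ i g * X = X := Iff.rfl
  obtain ⟨R, hRc, hRi⟩ := hi.exists_continuousOn_lift
    (M := fun p : E × E => frameRotation (F p.1) (F p.2))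
    (D := {p | ‖p.1‖ = 1 ∧ ‖p.2‖ = 1 ∧ p.1 ≠ -p.2})
    (continuousOn_frameRotation (by fun_prop) (by fun_prop) (fun p hp => hF1 hp.2.1)
      fun p hp => hFu _ _ hp.1 hp.2.1 hp.2.2) fun p hp => hFr _ _ hp.1 hp.2.1 hp.2.2
  have hRi' (v w : E) (hv : ‖v‖ = 1) (hw : ‖w‖ = 1) (hvw : v ≠ -w) :
      i (R (v, w)) = frameRotation (F v) (F w) := hRi (v, w) ⟨hv, hw, hvw⟩
  have hRK (v w : E) (hv : ‖v‖ = 1) (hw : ‖w‖ = 1) (hvw : v ≠ -w) : R (v, w) ∈ K := by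
    rw [hK, hRi' v w hv hw hvw, frameRotation_mul_of_orthogonal (hX v) (hX w)]
  have hRF (v w : E) (hv : ‖v‖ = 1) (hw : ‖w‖ = 1) (hvw : v ≠ -w) :
      i (R (v, w)) * F w = F v := by
    rw [hRi' v w hv hw hvw, frameRotation_mul (hF1 hw) (hFu v w hv hw hvw)]
  have hnorm (g) (hg : g ∈ K) : ‖col g‖ = 1 := by
    have h1 : (F (col g))ᴴ * F (col g) = 1 := by
      rw [hcolF g hg, conjTranspose_mul, Matrix.mul_assoc, ← Matrix.mul_assoc _ (i g), hu,
        Matrix.one_mul, hF1 he]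
    rw [hFn] at h1
    obtain ⟨k⟩ : Nonempty κ := inferInstance
    have h2 := congrFun (congrFun h1 k) k
    simp only [Matrix.smul_apply, one_apply_eq, smul_eq_mul, mul_one] at h2
    have h3 : ‖col g‖ ^ 2 = 1 := by exact_mod_cast h2
    exact (pow_eq_one_iff_of_nonneg (norm_nonneg _) two_ne_zero).1 h3
  obtain ⟨g, hfg, hg⟩ := exists_homotopic_constant_col hE K hcol hnorm R hRc hRK
    (fun v w hv hw hvw g hg hgw => hFinj (by
      rw [hcolF _ (K.mul_mem (hRK v w hv hw hvw) hg), map_mul, Matrix.mul_assoc, ← hcolF g hg,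
        hgw, hRF v w hv hw hvw]))
    (fun v w hv hw hvw g hg hgv => hFinj (by
      rw [hcolF _ (K.mul_mem (K.inv_mem (hRK v w hv hw hvw)) hg), map_mul, Matrix.mul_assoc,
        ← hcolF g hg, hgv, ← hRF v w hv hw hvw, ← Matrix.mul_assoc, hinv, Matrix.one_mul]))
    f hf
  exact ⟨g, hfg, fun t => ⟨(hg t).1, by rw [← hcolF _ (hg t).1, (hg t).2]⟩⟩

end Frames

section ExtendZero

variable {m : Type*} [DecidableEq m]

/-- Extension by zero of a vector supported on the complement of `T`. -/
def extendZero (T : Finset m) (v : EuclideanSpace ℂ {j // j ∉ T}) (j : m) : ℂ :=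
  if h : j ∈ T then 0 else v ⟨j, h⟩

lemma extendZero_of_mem {T : Finset m} (v : EuclideanSpace ℂ {j // j ∉ T}) {j : m} (h : j ∈ T) :
    extendZero T v j = 0 := dif_pos h

lemma extendZero_of_notMem {T : Finset m} (v : EuclideanSpace ℂ {j // j ∉ T}) {j : m}
    (h : j ∉ T) : extendZero T v j = v ⟨j, h⟩ := dif_neg h

lemma continuous_extendZero (T : Finset m) : Continuous (extendZero T) := by
  refine continuous_pi fun j => ?_
  by_cases h : j ∈ T
  · simpa only [extendZero_of_mem _ h] using continuous_const
  · simp only [extendZero_of_notMem _ h]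
    fun_prop

lemma extendZero_injective (T : Finset m) : Function.Injective (extendZero T) := by
  intro v w h
  ext j
  have := congrFun h j
  rwa [extendZero_of_notMem _ j.2, extendZero_of_notMem _ j.2] at this

lemma extendZero_restrict {T : Finset m} {x : m → ℂ} (hx : ∀ j ∈ T, x j = 0) :
    extendZero T (WithLp.toLp 2 fun j => x j) = x := by
  ext j
  by_cases h : j ∈ T
  · rw [extendZero_of_mem _ h, hx j h]
  · rw [extendZero_of_notMem _ h]

/-- The matrix whose columns are the basis vectors indexed by `T`. -/
def coordFrame (T : Finset m) : Matrix m T ℂ := (1 : Matrix m m ℂ).submatrix id Subtype.val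

lemma norm_toLp_one_col [Fintype m] {T : Finset m} {k : m} (hk : k ∉ T) :
    ‖(WithLp.toLp 2 fun j => (1 : Matrix m m ℂ) j k : EuclideanSpace ℂ {j // j ∉ T})‖ = 1 := by
  have : (WithLp.toLp 2 fun j => (1 : Matrix m m ℂ) j k : EuclideanSpace ℂ {j // j ∉ T}) =
      EuclideanSpace.single ⟨k, hk⟩ 1 := by
    ext j
    simp [Matrix.one_apply, Subtype.ext_iff]
  rw [this, PiLp.norm_single, norm_one]

variable [Fintype m]

lemma star_extendZero_dotProduct (T : Finset m) (v w : EuclideanSpace ℂ {j // j ∉ T}) :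
    star (extendZero T v) ⬝ᵥ extendZero T w = inner ℂ v w := by
  rw [EuclideanSpace.inner_eq_star_dotProduct, dotProduct_comm w.ofLp, dotProduct, dotProduct,
    ← Finset.sum_add_sum_compl T, Finset.sum_eq_zero, zero_add]
  · rw [Finset.sum_subtype (p := fun j => j ∉ T) Tᶜ fun j => Finset.mem_compl]
    refine Finset.sum_congr rfl fun j _ => ?_
    simp [extendZero_of_notMem _ j.2]
  · intro j hj
    rw [extendZero_of_mem _ hj, mul_zero]

lemma mul_coordFrame_eq_iff {T : Finset m} {A : Matrix m m ℂ} :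
    A * coordFrame T = coordFrame T ↔ ∀ j ∈ T, ∀ k, A k j = (1 : Matrix m m ℂ) k j := by
  have h : A * coordFrame T = A.submatrix id Subtype.val := by
    ext k j
    simp [coordFrame, Matrix.mul_apply, Matrix.one_apply]
  rw [h, coordFrame, ← Matrix.ext_iff]
  exact ⟨fun H j hj k => H k ⟨j, hj⟩, fun H k j => H j j.2 k⟩

lemma apply_of_mul_coordFrame_eq {T : Finset m} {A : Matrix m m ℂ} (hA : Aᴴ * A = 1)
    (h : A * coordFrame T = coordFrame T) {j : m} (hj : j ∈ T) (k : m) :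
    A j k = (1 : Matrix m m ℂ) j k := by
  have h1 : Aᴴ * coordFrame T = coordFrame T := by
    conv_lhs => rw [← h]
    rw [← Matrix.mul_assoc, hA, Matrix.one_mul]
  have h2 := mul_coordFrame_eq_iff.1 h1 j hj k
  rw [conjTranspose_apply, star_eq_iff_star_eq] at h2
  rw [← h2, Matrix.one_apply, Matrix.one_apply]
  rcases eq_or_ne k j with rfl | hjk
  · simp
  · simp [hjk, hjk.symm]

lemma coordFrame_insert {T : Finset m} {A : Matrix m m ℂ} {k : m}
    (hT : A * coordFrame T = coordFrame T) (hk : ∀ j, A j k = (1 : Matrix m m ℂ) j k) :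
    A * coordFrame (insert k T) = coordFrame (insert k T) := by
  rw [mul_coordFrame_eq_iff] at hT ⊢
  intro j hj
  rcases Finset.mem_insert.1 hj with rfl | hj
  exacts [hk, hT j hj]

end ExtendZero

section Unitary

variable {m : Type*} [DecidableEq m] [Fintype m]

lemma finrank_real_euclideanSpace_complex (κ : Type*) [Fintype κ] :
    Module.finrank ℝ (EuclideanSpace ℂ κ) = 2 * Fintype.card κ := by
  rw [← finrank_euclideanSpace (𝕜 := ℂ) (ι := κ)]
  exact finrank_real_of_complex _

lemma one_add_inner_ne_zero {E : Type*} [NormedAddCommGroup E] [InnerProductSpace ℂ E] {v w : E}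
    (hv : ‖v‖ = 1) (hw : ‖w‖ = 1) (h : v ≠ -w) : 1 + inner ℂ v w ≠ 0 := by
  intro H
  refine h ((inner_eq_one_iff_of_norm_eq_one (𝕜 := ℂ) hv (by rwa [norm_neg])).1 ?_)
  rw [inner_neg_right]
  linear_combination -H

lemma exists_homotopic_unitaryGroup_insert {ι : Type*} [Fintype ι] [Nonempty ι] {T : Finset m}
    {k : m} (hk : k ∉ T) (hT : Fintype.card ι + 1 < 2 * Fintype.card {j // j ∉ T})
    (f : Ω^ ι (unitaryGroup m ℂ) 1)
    (hf : ∀ t, (f t : Matrix m m ℂ) * coordFrame T = coordFrame T) :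
    ∃ g : Ω^ ι (unitaryGroup m ℂ) 1, GenLoop.Homotopic f g ∧
      ∀ t, (g t : Matrix m m ℂ) * coordFrame (insert k T) = coordFrame (insert k T) := by
  have hmul (v w : EuclideanSpace ℂ {j // j ∉ T}) :
      (replicateCol Unit (extendZero T v))ᴴ * replicateCol Unit (extendZero T w) =
        (inner ℂ v w : ℂ) • (1 : Matrix Unit Unit ℂ) := by
    ext
    simp only [conjTranspose_replicateCol, Matrix.smul_apply, smul_eq_mul, one_apply_eq, mul_one,
      ← star_extendZero_dotProduct]
    rfl
  have hone (j : m) (hj : j ∈ T) : (1 : Matrix m m ℂ) j k = 0 :=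
    Matrix.one_apply_ne fun h => hk (h ▸ hj)
  have hcol1 : extendZero T (WithLp.toLp 2 fun j => (1 : Matrix m m ℂ) j k) =
      fun j => (1 : Matrix m m ℂ) j k := extendZero_restrict (x := fun j => _) hone
  have hcol (g : unitaryGroup m ℂ) (hg : (g : Matrix m m ℂ) * coordFrame T = coordFrame T) :
      extendZero T (WithLp.toLp 2 fun j => (g : Matrix m m ℂ) j k) =
        fun j => (g : Matrix m m ℂ) j k :=
    extendZero_restrict (x := fun j => (g : Matrix m m ℂ) j k) fun j hj => by
      rw [apply_of_mul_coordFrame_eq g.2.1 hg hj, hone j hj]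
  have hF1 (v : EuclideanSpace ℂ {j // j ∉ T}) (hv : ‖v‖ = 1) :
      (replicateCol Unit (extendZero T v))ᴴ * replicateCol Unit (extendZero T v) = 1 := by
    rw [hmul, inner_self_eq_norm_sq_to_K, hv]
    simp
  have hFu (v w : EuclideanSpace ℂ {j // j ∉ T}) (hv : ‖v‖ = 1) (hw : ‖w‖ = 1) (h : v ≠ -w) :
      IsUnit (1 + (replicateCol Unit (extendZero T v))ᴴ *
        replicateCol Unit (extendZero T w)).det := by
    have : (1 : Matrix Unit Unit ℂ) + (inner ℂ v w : ℂ) • 1 = (1 + inner ℂ v w : ℂ) • 1 := by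
      rw [add_smul, one_smul]
    rw [hmul, this, det_smul, det_one, mul_one]
    exact (pow_ne_zero _ (one_add_inner_ne_zero hv hw h)).isUnit
  obtain ⟨g, hfg, hg⟩ := exists_homotopic_fixing_frame (ι := ι) (κ := Unit)
    (E := EuclideanSpace ℂ {j // j ∉ T})
    (by rwa [finrank_real_euclideanSpace_complex]) (i := (unitaryGroup m ℂ).subtype)
    Topology.IsInducing.subtypeVal (fun g => g.2.1)
    (F := fun v => replicateCol Unit (extendZero T v))
    ((continuous_extendZero T).matrix_replicateCol)
    (fun v w h => extendZero_injective T (replicateCol_injective h))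
    (fun v => by rw [hmul, inner_self_eq_norm_sq_to_K]; norm_cast) hFu
    (fun v w hv hw h => ⟨⟨_, mem_unitaryGroup_iff'.2
      (frameRotation_conjTranspose_mul_self (hF1 v hv) (hF1 w hw) (hFu v w hv hw h))⟩, rfl⟩)
    (coordFrame T) (fun v => by
      ext a j
      simp [coordFrame, Matrix.mul_apply, Matrix.one_apply, extendZero_of_mem v j.2])
    (col := fun g => WithLp.toLp 2 fun j => (g : Matrix m m ℂ) j k)
    ((PiLp.continuous_toLp 2 _).comp (continuous_pi fun j =>
      (continuous_subtype_val : Continuous fun g : unitaryGroup m ℂ => g.1).matrix_elem _ _))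
    (norm_toLp_one_col hk) (fun g hg => by
      rw [hcol g hg, OneMemClass.coe_one, hcol1]
      ext j
      simp [Matrix.mul_apply, Matrix.one_apply]) f hf
  refine ⟨g, hfg, fun t => coordFrame_insert (hg t).1 fun j => ?_⟩
  have := congrFun (congrFun (hg t).2 j) ()
  rw [OneMemClass.coe_one, hcol1] at this
  simpa [Matrix.mul_apply, Matrix.one_apply] using this

end Unitary

section Quaternionic

/-- `M` commutes with the antilinear maps `x ↦ star (J x)` and `x ↦ star (J' x)`. -/
def Intertwines {m κ : Type*} [Fintype m] [Fintype κ] (J : Matrix m m ℂ) (J' : Matrix κ κ ℂ)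
    (M : Matrix m κ ℂ) : Prop :=
  J * M = M.map star * J'

namespace Intertwines

variable {m κ τ : Type*} [Fintype m] [Fintype κ] [Fintype τ] {J : Matrix m m ℂ}
  {J' : Matrix κ κ ℂ} {J'' : Matrix τ τ ℂ}

lemma mul {A : Matrix m κ ℂ} {B : Matrix κ τ ℂ} (hA : Intertwines J J' A)
    (hB : Intertwines J' J'' B) : Intertwines J J'' (A * B) := by
  unfold Intertwines at *
  have : (A * B).map star = A.map star * B.map star := Matrix.map_mul (f := starRingEnd ℂ)
  rw [this, ← Matrix.mul_assoc, hA, Matrix.mul_assoc, hB, Matrix.mul_assoc]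

lemma add {A B : Matrix m κ ℂ} (hA : Intertwines J J' A) (hB : Intertwines J J' B) :
    Intertwines J J' (A + B) := by
  unfold Intertwines at *
  have : (A + B).map star = A.map star + B.map star := Matrix.map_add _ (star_add (R := ℂ)) _ _
  rw [this, Matrix.mul_add, Matrix.add_mul, hA, hB]

lemma sub {A B : Matrix m κ ℂ} (hA : Intertwines J J' A) (hB : Intertwines J J' B) :
    Intertwines J J' (A - B) := by
  unfold Intertwines at *
  have : (A - B).map star = A.map star - B.map star := Matrix.map_sub _ (star_sub (R := ℂ)) _ _
  rw [this, Matrix.mul_sub, Matrix.sub_mul, hA, hB]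

lemma one [DecidableEq m] : Intertwines J J (1 : Matrix m m ℂ) := by
  have : (1 : Matrix m m ℂ).map star = 1 := Matrix.map_one _ (star_zero ℂ) (star_one ℂ)
  rw [Intertwines, this, Matrix.mul_one, Matrix.one_mul]

lemma conjTranspose {A : Matrix m κ ℂ} (hJ : Jᵀ = -J) (hJ' : J'ᵀ = -J')
    (hA : Intertwines J J' A) : Intertwines J' J Aᴴ := by
  unfold Intertwines at *
  have := congrArg Matrix.transpose hA
  rw [transpose_mul, transpose_mul, hJ, hJ', Matrix.mul_neg, Matrix.neg_mul, neg_inj] at this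
  have h : Aᴴ.map star = Aᵀ := by
    ext
    simp
  rw [h, this]
  rfl

lemma inv [DecidableEq m] {A : Matrix m m ℂ} (hA : Intertwines J J A) (h : IsUnit A.det) :
    Intertwines J J A⁻¹ := by
  unfold Intertwines at *
  have h1 : (A⁻¹).map star * A.map star = 1 := by
    have : (A⁻¹ * A).map star = (A⁻¹).map star * A.map star := Matrix.map_mul (f := starRingEnd ℂ)
    rw [← this, nonsing_inv_mul _ h]
    exact Matrix.map_one _ (star_zero ℂ) (star_one ℂ)
  calc J * A⁻¹ = (A⁻¹).map star * (A.map star * J) * A⁻¹ := by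
        rw [← Matrix.mul_assoc, h1, Matrix.one_mul]
    _ = (A⁻¹).map star * J := by
        rw [← hA, Matrix.mul_assoc, Matrix.mul_assoc, mul_nonsing_inv _ h, Matrix.mul_one]

lemma frameRotation [DecidableEq m] [DecidableEq κ] {V W : Matrix m κ ℂ} (hJ : Jᵀ = -J)
    (hJ' : J'ᵀ = -J') (hV : Intertwines J J' V) (hW : Intertwines J J' W)
    (hVW : IsUnit (1 + Vᴴ * W).det) (hWW : IsUnit (1 + Wᴴ * W).det) :
    Intertwines J J (frameRotation V W) := by
  have key {V W : Matrix m κ ℂ} (hV : Intertwines J J' V) (hW : Intertwines J J' W)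
      (hVW : IsUnit (1 + Vᴴ * W).det) : Intertwines J J (frameReflection V W) :=
    (((hV.add hW).mul ((one.add ((hV.conjTranspose hJ hJ').mul hW)).inv hVW)).mul
      ((hV.add hW).conjTranspose hJ hJ')).sub one
  exact (key hV hW hVW).mul (key hW hW hWW)

end Intertwines

lemma transpose_Jmat (n : ℕ) : (Jmat n)ᵀ = -Jmat n := by
  simp [Jmat, fromBlocks_transpose, fromBlocks_neg]

/-- The standard symplectic form on `ℂ²`. -/
def quatForm : Matrix (Fin 2) (Fin 2) ℂ := !![0, 1; -1, 0]

lemma transpose_quatForm : quatFormᵀ = -quatForm := by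
  ext i j
  fin_cases i <;> fin_cases j <;> simp [quatForm]

lemma intertwines_quatForm_iff {A : Matrix (Fin 2) (Fin 2) ℂ} :
    Intertwines quatForm quatForm A ↔ A 1 0 = -star (A 0 1) ∧ A 1 1 = star (A 0 0) := by
  rw [Intertwines, ← Matrix.ext_iff]
  simp only [Fin.forall_fin_two, Matrix.mul_apply, Fin.sum_univ_two, quatForm, map_apply]
  simp
  intro h1 h2
  simp [h1, h2]

lemma Intertwines.det_eq {A : Matrix (Fin 2) (Fin 2) ℂ} (hA : Intertwines quatForm quatForm A) :
    A.det = ((‖A 0 0‖ ^ 2 + ‖A 1 0‖ ^ 2 : ℝ) : ℂ) := by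
  obtain ⟨h1, h2⟩ := intertwines_quatForm_iff.1 hA
  have h3 : A 0 1 = - star (A 1 0) := by rw [h1, star_neg, star_star, neg_neg]
  rw [det_fin_two, h2, h3]
  push_cast
  rw [← Complex.mul_conj', ← Complex.mul_conj']
  simp
  ring

lemma mem_Sp_iff {A : unitaryGroup (Fin n ⊕ Fin n) ℂ} :
    A ∈ Sp n ↔ Intertwines (Jmat n) (Jmat n) A.1 := by
  have h1 : A.1ᵀ * A.1.map star = 1 := by
    have := congrArg Matrix.transpose A.2.1
    rwa [transpose_mul, transpose_one, star_eq_conjTranspose] at this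
  have h2 : A.1.map star * A.1ᵀ = 1 := mul_eq_one_comm.1 h1
  change A.1ᵀ * Jmat n * A.1 = Jmat n ↔ Jmat n * A.1 = A.1.map star * Jmat n
  constructor
  · intro h
    conv_rhs => rw [← h]
    rw [Matrix.mul_assoc, ← Matrix.mul_assoc, h2, Matrix.one_mul]
  · intro h
    rw [Matrix.mul_assoc, h, ← Matrix.mul_assoc, h1, Matrix.one_mul]

/-- The `2n × 2` matrix with columns `x` and its image under the quaternionic structure. -/
def quatFrame (x : Fin n ⊕ Fin n → ℂ) : Matrix (Fin n ⊕ Fin n) (Fin 2) ℂ :=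
  Matrix.of fun k => ![x k, Sum.elim (fun i => -star (x (Sum.inr i)))
    (fun i => star (x (Sum.inl i))) k]

@[simp]
lemma quatFrame_zero (x : Fin n ⊕ Fin n → ℂ) (k : Fin n ⊕ Fin n) : quatFrame x k 0 = x k := rfl

@[simp]
lemma quatFrame_inl_one (x : Fin n ⊕ Fin n → ℂ) (k : Fin n) :
    quatFrame x (Sum.inl k) 1 = -star (x (Sum.inr k)) := rfl

@[simp]
lemma quatFrame_inr_one (x : Fin n ⊕ Fin n → ℂ) (k : Fin n) :
    quatFrame x (Sum.inr k) 1 = star (x (Sum.inl k)) := rfl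

lemma intertwines_iff_eq_quatFrame {M : Matrix (Fin n ⊕ Fin n) (Fin 2) ℂ} :
    Intertwines (Jmat n) quatForm M ↔ M = quatFrame fun k => M k 0 := by
  rw [Intertwines, ← Matrix.ext_iff, ← Matrix.ext_iff]
  simp [Matrix.mul_apply, Fin.sum_univ_two, quatForm, Jmat, Matrix.one_apply, fromBlocks]
  constructor
  · rintro ⟨h1, h2⟩
    exact ⟨fun a => by rw [← (h2 a).2, neg_neg], fun a => (h1 a).2⟩
  · rintro ⟨h1, h2⟩
    exact ⟨fun a => ⟨by simp [h1], h2 a⟩, fun a => ⟨by simp [h2], by simp [h1]⟩⟩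

lemma intertwines_quatFrame (x : Fin n ⊕ Fin n → ℂ) :
    Intertwines (Jmat n) quatForm (quatFrame x) :=
  intertwines_iff_eq_quatFrame.2 rfl

lemma continuous_quatFrame : Continuous (quatFrame (n := n)) := by
  refine continuous_matrix fun k j => ?_
  fin_cases j <;> rcases k with k | k <;> simp <;> fun_prop

lemma intertwines_conjTranspose_mul_quatFrame (x y : Fin n ⊕ Fin n → ℂ) :
    Intertwines quatForm quatForm ((quatFrame x)ᴴ * quatFrame y) :=
  ((intertwines_quatFrame x).conjTranspose (transpose_Jmat n) transpose_quatForm).mul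
    (intertwines_quatFrame y)

lemma conjTranspose_quatFrame_mul_self (x : Fin n ⊕ Fin n → ℂ) :
    (quatFrame x)ᴴ * quatFrame x = (star x ⬝ᵥ x) • (1 : Matrix (Fin 2) (Fin 2) ℂ) := by
  obtain ⟨h1, h2⟩ := intertwines_quatForm_iff.1 (intertwines_conjTranspose_mul_quatFrame x x)
  have h0 : ((quatFrame x)ᴴ * quatFrame x) 0 0 = star x ⬝ᵥ x := rfl
  have h3 : ((quatFrame x)ᴴ * quatFrame x) 0 1 = 0 := by
    simp [Matrix.mul_apply, mul_comm]
  ext i j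
  fin_cases i <;> fin_cases j
  · simp [h0]
  · simp [h3]
  · simp [h1, h3]
  · simp [h2, h0]
    simp [dotProduct, mul_comm]

lemma isUnit_det_one_add_conjTranspose_mul_quatFrame {x y : Fin n ⊕ Fin n → ℂ}
    (h : 1 + star x ⬝ᵥ y ≠ 0) : IsUnit (1 + (quatFrame x)ᴴ * quatFrame y).det := by
  rw [isUnit_iff_ne_zero,
    (Intertwines.one.add (intertwines_conjTranspose_mul_quatFrame x y)).det_eq]
  have h0 : (1 + (quatFrame x)ᴴ * quatFrame y : Matrix (Fin 2) (Fin 2) ℂ) 0 0 =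
      1 + star x ⬝ᵥ y := rfl
  rw [h0, Complex.ofReal_ne_zero]
  have := norm_pos_iff.2 h
  positivity

lemma quatFrame_one_col (k : Fin n) :
    quatFrame (fun j => (1 : Matrix (Fin n ⊕ Fin n) (Fin n ⊕ Fin n) ℂ) j (Sum.inl k)) =
      (1 : Matrix (Fin n ⊕ Fin n) (Fin n ⊕ Fin n) ℂ).submatrix id ![Sum.inl k, Sum.inr k] := by
  ext i j
  fin_cases j <;> rcases i with i | i <;> simp [Matrix.one_apply, apply_ite]

lemma mul_submatrix_one_id {m κ : Type*} [Fintype m] [DecidableEq m] (A : Matrix m m ℂ)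
    (c : κ → m) : A * (1 : Matrix m m ℂ).submatrix id c = A.submatrix id c := by
  ext i j
  simp [Matrix.mul_apply, Matrix.one_apply]

/-- The inclusion of `Sp(2n)` in the `2n × 2n` matrices. -/
def spInclusion (n : ℕ) : Sp n →* Matrix (Fin n ⊕ Fin n) (Fin n ⊕ Fin n) ℂ :=
  (unitaryGroup (Fin n ⊕ Fin n) ℂ).subtype.comp (Sp n).subtype

lemma isInducing_spInclusion (n : ℕ) : Topology.IsInducing (spInclusion n) :=
  Topology.IsInducing.subtypeVal.comp Topology.IsInducing.subtypeVal

lemma conjTranspose_spInclusion_mul_self (g : Sp n) :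
    (spInclusion n g)ᴴ * spInclusion n g = 1 := g.1.2.1

lemma mem_range_spInclusion_iff {A : Matrix (Fin n ⊕ Fin n) (Fin n ⊕ Fin n) ℂ} :
    A ∈ Set.range (spInclusion n) ↔ Aᴴ * A = 1 ∧ Intertwines (Jmat n) (Jmat n) A := by
  constructor
  · rintro ⟨g, rfl⟩
    exact ⟨conjTranspose_spInclusion_mul_self g, mem_Sp_iff.1 g.2⟩
  · rintro ⟨h1, h2⟩
    exact ⟨⟨⟨A, mem_unitaryGroup_iff'.2 h1⟩, mem_Sp_iff.2 h2⟩, rfl⟩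

lemma exists_homotopic_Sp_insert {ι : Type*} [Fintype ι] [Nonempty ι] {S : Finset (Fin n)}
    {k : Fin n} (hk : k ∉ S)
    (hS : Fintype.card ι + 1 < 2 * Fintype.card {j // j ∉ S.disjSum S})
    (f : Ω^ ι (Sp n) 1)
    (hf : ∀ t, spInclusion n (f t) * coordFrame (S.disjSum S) =
      coordFrame (S.disjSum S)) :
    ∃ g : Ω^ ι (Sp n) 1, GenLoop.Homotopic f g ∧
      ∀ t, spInclusion n (g t) *
        coordFrame ((insert k S).disjSum (insert k S)) =
          coordFrame ((insert k S).disjSum (insert k S)) := by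
  have hk' : (Sum.inl k : Fin n ⊕ Fin n) ∉ S.disjSum S := by simpa using hk
  have hone (j : Fin n ⊕ Fin n) (hj : j ∈ S.disjSum S) :
      (1 : Matrix (Fin n ⊕ Fin n) (Fin n ⊕ Fin n) ℂ) j (Sum.inl k) = 0 :=
    Matrix.one_apply_ne fun h => hk' (h ▸ hj)
  have hcol1 : extendZero (S.disjSum S) (WithLp.toLp 2 fun j =>
      (1 : Matrix (Fin n ⊕ Fin n) (Fin n ⊕ Fin n) ℂ) j (Sum.inl k)) =
        fun j => (1 : Matrix (Fin n ⊕ Fin n) (Fin n ⊕ Fin n) ℂ) j (Sum.inl k) :=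
    extendZero_restrict (x := fun j => _) hone
  have hcol (g : Sp n) (hg : spInclusion n g * coordFrame (S.disjSum S) =
      coordFrame (S.disjSum S)) :
      extendZero (S.disjSum S) (WithLp.toLp 2 fun j => spInclusion n g j (Sum.inl k)) =
        fun j => spInclusion n g j (Sum.inl k) :=
    extendZero_restrict (x := fun j => spInclusion n g j (Sum.inl k)) fun j hj => by
      rw [apply_of_mul_coordFrame_eq (conjTranspose_spInclusion_mul_self g) hg hj]
      exact hone j hj
  have hFn (v : EuclideanSpace ℂ {j // j ∉ S.disjSum S}) :
      (quatFrame (extendZero _ v))ᴴ * quatFrame (extendZero _ v) =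
        ((‖v‖ ^ 2 : ℝ) : ℂ) • (1 : Matrix (Fin 2) (Fin 2) ℂ) := by
    rw [conjTranspose_quatFrame_mul_self, star_extendZero_dotProduct, inner_self_eq_norm_sq_to_K]
    norm_cast
  have hFu (v w : EuclideanSpace ℂ {j // j ∉ S.disjSum S}) (hv : ‖v‖ = 1) (hw : ‖w‖ = 1)
      (h : v ≠ -w) :
      IsUnit (1 + (quatFrame (extendZero _ v))ᴴ * quatFrame (extendZero _ w)).det := by
    apply isUnit_det_one_add_conjTranspose_mul_quatFrame
    rw [star_extendZero_dotProduct]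
    exact one_add_inner_ne_zero hv hw h
  have hF1 (v : EuclideanSpace ℂ {j // j ∉ S.disjSum S}) (hv : ‖v‖ = 1) :
      (quatFrame (extendZero _ v))ᴴ * quatFrame (extendZero _ v) = 1 := by
    simp [hFn, hv]
  obtain ⟨g, hfg, hg⟩ := exists_homotopic_fixing_frame (ι := ι) (κ := Fin 2) (G := Sp n)
    (E := EuclideanSpace ℂ {j // j ∉ S.disjSum S})
    (by rwa [finrank_real_euclideanSpace_complex])
    (i := spInclusion n)
    (isInducing_spInclusion n) conjTranspose_spInclusion_mul_self
    (F := fun v => quatFrame (extendZero _ v))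
    (continuous_quatFrame.comp (continuous_extendZero _))
    (fun v w h => extendZero_injective _ (funext fun j => congrFun (congrFun h j) 0))
    hFn hFu
    (fun v w hv hw h => mem_range_spInclusion_iff.2
      ⟨frameRotation_conjTranspose_mul_self (hF1 v hv) (hF1 w hw) (hFu v w hv hw h),
        Intertwines.frameRotation (transpose_Jmat n) transpose_quatForm
          (intertwines_quatFrame _) (intertwines_quatFrame _) (hFu v w hv hw h)
          (isUnit_det_one_add_self (hF1 w hw))⟩)
    (coordFrame (S.disjSum S)) (fun v => by
      ext a j
      have hT := fun i => extendZero_of_mem (T := S.disjSum S) v (j := i)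
      obtain ⟨j | j, hj⟩ := j <;> fin_cases a <;>
        simp [coordFrame, Matrix.mul_apply, Matrix.one_apply]
      exacts [hT _ hj, hT _ (by simpa using hj), hT _ hj, hT _ (by simpa using hj)])
    (col := fun g => WithLp.toLp 2 fun j => spInclusion n g j (Sum.inl k))
    ((PiLp.continuous_toLp 2 _).comp (continuous_pi fun j =>
      (isInducing_spInclusion n).continuous.matrix_elem _ _))
    (norm_toLp_one_col hk') (fun g hg => by
      have h1 := intertwines_iff_eq_quatFrame.1
        ((mem_range_spInclusion_iff.1 ⟨g, rfl⟩).2.mul (intertwines_quatFrame fun j =>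
          (1 : Matrix (Fin n ⊕ Fin n) (Fin n ⊕ Fin n) ℂ) j (Sum.inl k)))
      rw [hcol g hg]
      rw [map_one, hcol1]
      refine Eq.trans ?_ h1.symm
      congr 1
      ext j
      simp [Matrix.mul_apply, Matrix.one_apply]) f hf
  refine ⟨g, hfg, fun t => mul_coordFrame_eq_iff.2 ?_⟩
  have h1 := mul_coordFrame_eq_iff.1 (hg t).1
  have h2 := (hg t).2
  rw [map_one, hcol1, quatFrame_one_col, mul_submatrix_one_id] at h2
  have h3 (j) := congrFun (congrFun h2 j) 0
  have h4 (j) := congrFun (congrFun h2 j) 1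
  rintro (j | j) hj i
  · rcases Finset.mem_insert.1 (Finset.inl_mem_disjSum.1 hj) with rfl | hj
    · exact h3 i
    · exact h1 _ (Finset.inl_mem_disjSum.2 hj) i
  · rcases Finset.mem_insert.1 (Finset.inr_mem_disjSum.1 hj) with rfl | hj
    · exact h4 i
    · exact h1 _ (Finset.inr_mem_disjSum.2 hj) i

end Quaternionic

section Reduction

lemma exists_homotopic_Sp_of_notMem {k₀ : Fin n} (f : Ω^ (Fin 3) (Sp n) 1) {S : Finset (Fin n)}
    (hS : k₀ ∉ S) :
    ∃ g : Ω^ (Fin 3) (Sp n) 1, GenLoop.Homotopic f g ∧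
      ∀ t, spInclusion n (g t) * coordFrame (S.disjSum S) = coordFrame (S.disjSum S) := by
  induction S using Finset.induction_on with
  | empty => exact ⟨f, .refl f, fun t => mul_coordFrame_eq_iff.2 (by simp)⟩
  | insert k S hk ih =>
    obtain ⟨g, hfg, hg⟩ := ih fun h => hS (Finset.mem_insert_of_mem h)
    obtain ⟨g', hgg', hg'⟩ := exists_homotopic_Sp_insert hk (by
      have h := Finset.card_le_univ (insert k₀ (insert k S))
      rw [Finset.card_insert_of_notMem hS, Finset.card_insert_of_notMem hk] at h
      simp only [Fintype.card_fin] at h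
      simp
      omega) g hg
    exact ⟨g', hfg.trans hgg', hg'⟩

lemma exists_homotopic_unitaryGroup_of_notMem {k₀ k₁ : Fin n} (h₀₁ : k₀ ≠ k₁)
    (f : Ω^ (Fin 3) (unitaryGroup (Fin n) ℂ) 1) {S : Finset (Fin n)} (h₀ : k₀ ∉ S) (h₁ : k₁ ∉ S) :
    ∃ g : Ω^ (Fin 3) (unitaryGroup (Fin n) ℂ) 1, GenLoop.Homotopic f g ∧
      ∀ t, (g t : Matrix (Fin n) (Fin n) ℂ) * coordFrame S = coordFrame S := by
  induction S using Finset.induction_on with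
  | empty => exact ⟨f, .refl f, fun t => mul_coordFrame_eq_iff.2 (by simp)⟩
  | insert k S hk ih =>
    obtain ⟨g, hfg, hg⟩ := ih (fun h => h₀ (Finset.mem_insert_of_mem h))
      fun h => h₁ (Finset.mem_insert_of_mem h)
    obtain ⟨g', hgg', hg'⟩ := exists_homotopic_unitaryGroup_insert hk (by
      have h := Finset.card_le_univ (insert k₀ (insert k₁ (insert k S)))
      rw [Finset.card_insert_of_notMem (by simp_all), Finset.card_insert_of_notMem h₁,
        Finset.card_insert_of_notMem hk] at h
      simp only [Fintype.card_fin] at h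
      simp
      omega) g hg
    exact ⟨g', hfg.trans hgg', hg'⟩

/-- The inclusion of `SU(n)` in the `n × n` matrices. -/
def suInclusion (n : ℕ) : SU n →* Matrix (Fin n) (Fin n) ℂ :=
  (unitaryGroup (Fin n) ℂ).subtype.comp (SU n).subtype

lemma isInducing_suInclusion (n : ℕ) : Topology.IsInducing (suInclusion n) :=
  Topology.IsInducing.subtypeVal.comp Topology.IsInducing.subtypeVal

lemma conjTranspose_suInclusion_mul_self (g : SU n) :
    (suInclusion n g)ᴴ * suInclusion n g = 1 := g.1.2.1

lemma det_suInclusion (g : SU n) : (suInclusion n g).det = 1 := g.2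

/-- A unitary matrix of determinant one as an element of `SU(n)`. -/
def SU.ofMatrix (A : Matrix (Fin n) (Fin n) ℂ) (h : Aᴴ * A = 1) (hd : A.det = 1) : SU n :=
  ⟨⟨A, mem_unitaryGroup_iff'.2 h⟩, hd⟩

lemma suInclusion_injective (n : ℕ) : Function.Injective (suInclusion n) :=
  Subtype.val_injective.comp Subtype.val_injective

lemma spInclusion_injective (n : ℕ) : Function.Injective (spInclusion n) :=
  Subtype.val_injective.comp Subtype.val_injective

lemma star_det_mul_det {m : Type*} [Fintype m] [DecidableEq m] {A : Matrix m m ℂ}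
    (h : Aᴴ * A = 1) : star A.det * A.det = 1 := by
  rw [← det_conjTranspose, ← det_mul, h, det_one]

/-- The retraction of the unitary group on `SU(n)` that rescales the column `k`. -/
def unitaryToSU (k : Fin n) : C(unitaryGroup (Fin n) ℂ, SU n) where
  toFun A := SU.ofMatrix
    ((A : Matrix (Fin n) (Fin n) ℂ) * diagonal (Function.update 1 k (star A.1.det))) (by
      have h := mul_comm (star A.1.det) A.1.det ▸ star_det_mul_det A.2.1
      have hA : (A.1)ᴴ * A.1 = 1 := A.2.1
      rw [conjTranspose_mul, Matrix.mul_assoc, ← Matrix.mul_assoc _ A.1, hA, Matrix.one_mul,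
        diagonal_conjTranspose, diagonal_mul_diagonal, ← diagonal_one]
      congr 1
      ext j
      rcases eq_or_ne j k with rfl | hj
      · simpa using h
      · simp [hj]) (by
      have h := mul_comm (star A.1.det) A.1.det ▸ star_det_mul_det A.2.1
      rw [det_mul, det_diagonal, Finset.prod_update_of_mem (Finset.mem_univ k)]
      simpa using h)
  continuous_toFun := by
    rw [(isInducing_suInclusion n).continuous_iff]
    change Continuous fun A : unitaryGroup (Fin n) ℂ =>
      (A : Matrix (Fin n) (Fin n) ℂ) * diagonal (Function.update 1 k (star A.1.det))
    refine continuous_subtype_val.matrix_mul (Continuous.matrix_diagonal ?_)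
    exact continuous_const.update k continuous_subtype_val.matrix_det.star

lemma suInclusion_unitaryToSU (k : Fin n) (A : unitaryGroup (Fin n) ℂ) :
    suInclusion n (unitaryToSU k A) =
      (A : Matrix (Fin n) (Fin n) ℂ) * diagonal (Function.update 1 k (star A.1.det)) := rfl

lemma unitaryToSU_coe (k : Fin n) (A : SU n) : unitaryToSU k A = A := by
  apply suInclusion_injective
  have h : A.1.1.det = 1 := A.2
  rw [suInclusion_unitaryToSU, h, star_one, ← Pi.one_apply (M := fun _ : Fin n => ℂ) k,
    Function.update_eq_self]
  simp [suInclusion]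

lemma exists_homotopic_SU {k₀ k₁ : Fin n} (h₀₁ : k₀ ≠ k₁) (f : Ω^ (Fin 3) (SU n) 1)
    {S : Finset (Fin n)} (h₀ : k₀ ∉ S) (h₁ : k₁ ∉ S) :
    ∃ g : Ω^ (Fin 3) (SU n) 1, GenLoop.Homotopic f g ∧
      ∀ t, suInclusion n (g t) * coordFrame S = coordFrame S := by
  obtain ⟨g, hfg, hg⟩ := exists_homotopic_unitaryGroup_of_notMem h₀₁
    (GenLoop.map ⟨Subtype.val, continuous_subtype_val⟩ rfl f) h₀ h₁
  have hρ : unitaryToSU k₀ 1 = 1 := unitaryToSU_coe k₀ 1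
  refine ⟨GenLoop.map (unitaryToSU k₀) hρ g, ?_, fun t => ?_⟩
  · have h := hfg.map (unitaryToSU k₀) hρ
    have hf : GenLoop.map (unitaryToSU k₀) hρ
        (GenLoop.map ⟨Subtype.val, continuous_subtype_val⟩ rfl f) = f :=
      GenLoop.ext _ _ fun t => unitaryToSU_coe k₀ (f t)
    rwa [hf] at h
  · rw [GenLoop.map_apply, suInclusion_unitaryToSU, mul_coordFrame_eq_iff]
    intro j hj k
    have hjk : j ≠ k₀ := fun h => h₀ (h ▸ hj)
    rw [mul_diagonal, Function.update_of_ne hjk, mul_coordFrame_eq_iff.1 (hg t) j hj]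
    simp

end Reduction

section FrameEmbedding

variable {m κ : Type*} [DecidableEq m] [Fintype κ] [DecidableEq κ]

/-- The matrix acting as `q` on the span of the frame `V` and trivially on its complement. -/
def frameEmbedding (V : Matrix m κ ℂ) (q : Matrix κ κ ℂ) : Matrix m m ℂ :=
  1 + V * (q - 1) * Vᴴ

lemma frameEmbedding_one (V : Matrix m κ ℂ) : frameEmbedding V 1 = 1 := by
  simp [frameEmbedding]

lemma conjTranspose_frameEmbedding (V : Matrix m κ ℂ) (q : Matrix κ κ ℂ) :
    (frameEmbedding V q)ᴴ = frameEmbedding V qᴴ := by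
  simp [frameEmbedding, Matrix.mul_assoc]

lemma submatrix_one_mul_conjTranspose_add {T : Finset m} {c : Fin 2 → m} (hc : c 0 ≠ c 1)
    (hT : ∀ j, j ∈ T ↔ j ≠ c 0 ∧ j ≠ c 1) :
    (1 : Matrix m m ℂ).submatrix id c * ((1 : Matrix m m ℂ).submatrix id c)ᴴ +
      coordFrame T * (coordFrame T)ᴴ = 1 := by
  ext i j
  have h : ∑ t ∈ T.attach, (1 : Matrix m m ℂ) i t * (1 : Matrix m m ℂ) t j =
      ∑ t ∈ T, (1 : Matrix m m ℂ) i t * (1 : Matrix m m ℂ) t j :=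
    Finset.sum_attach T fun t => (1 : Matrix m m ℂ) i t * (1 : Matrix m m ℂ) t j
  simp [Matrix.mul_apply, coordFrame, Fin.sum_univ_two]
  refine (congrArg _ h).trans ?_
  simp [Matrix.one_apply]
  rcases eq_or_ne (c 0) j with rfl | h₀
  · simp [hT, hc.symm]
  rcases eq_or_ne (c 1) j with rfl | h₁
  · simp [hT, hc]
  · simp [hT, h₀, h₁, h₀.symm, h₁.symm]

variable [Fintype m]

lemma frameEmbedding_mul {V : Matrix m κ ℂ} (hV : Vᴴ * V = 1) (p q : Matrix κ κ ℂ) :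
    frameEmbedding V p * frameEmbedding V q = frameEmbedding V (p * q) := by
  have h : V * (p - 1) * Vᴴ * (V * (q - 1) * Vᴴ) = V * ((p - 1) * (q - 1)) * Vᴴ := by
    calc _ = V * ((p - 1) * (Vᴴ * V) * (q - 1)) * Vᴴ := by simp only [Matrix.mul_assoc]
      _ = _ := by rw [hV, Matrix.mul_one]
  have h' : p * q - 1 = (p - 1) * (q - 1) + (p - 1) + (q - 1) := by noncomm_ring
  simp only [frameEmbedding, h', Matrix.mul_add, Matrix.add_mul, Matrix.one_mul, Matrix.mul_one, h]
  abel

lemma frameEmbedding_mul_of_orthogonal {V W : Matrix m κ ℂ} (h : Vᴴ * W = 0) (p q : Matrix κ κ ℂ) :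
    frameEmbedding V p * frameEmbedding W q = 1 + V * (p - 1) * Vᴴ + W * (q - 1) * Wᴴ := by
  have h : V * (p - 1) * Vᴴ * (W * (q - 1) * Wᴴ) = 0 := by
    calc _ = V * (p - 1) * (Vᴴ * W) * ((q - 1) * Wᴴ) := by simp only [Matrix.mul_assoc]
      _ = _ := by rw [h, Matrix.mul_zero, Matrix.zero_mul]
  simp only [frameEmbedding, Matrix.mul_add, Matrix.add_mul, Matrix.one_mul, Matrix.mul_one, h]
  abel

lemma frameEmbedding_mul_frame {V : Matrix m κ ℂ} (hV : Vᴴ * V = 1) (q : Matrix κ κ ℂ) :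
    frameEmbedding V q * V = V * q := by
  rw [frameEmbedding, Matrix.add_mul, Matrix.mul_assoc _ Vᴴ, hV, Matrix.one_mul, Matrix.mul_one,
    Matrix.mul_sub, Matrix.mul_one, add_sub_cancel]

lemma conjTranspose_frameEmbedding_mul_self {V : Matrix m κ ℂ} (hV : Vᴴ * V = 1)
    {q : Matrix κ κ ℂ} (hq : qᴴ * q = 1) :
    (frameEmbedding V q)ᴴ * frameEmbedding V q = 1 := by
  rw [conjTranspose_frameEmbedding, frameEmbedding_mul hV, hq, frameEmbedding_one]

lemma det_frameEmbedding {V : Matrix m κ ℂ} (hV : Vᴴ * V = 1) (q : Matrix κ κ ℂ) :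
    (frameEmbedding V q).det = q.det := by
  rw [frameEmbedding, Matrix.mul_assoc, det_one_add_mul_comm, Matrix.mul_assoc, hV, Matrix.mul_one,
    add_sub_cancel]

lemma Intertwines.frameEmbedding {J : Matrix m m ℂ} {J' : Matrix κ κ ℂ} {V : Matrix m κ ℂ}
    {q : Matrix κ κ ℂ} (hJ : Jᵀ = -J) (hJ' : J'ᵀ = -J') (hV : Intertwines J J' V)
    (hq : Intertwines J' J' q) : Intertwines J J (frameEmbedding V q) :=
  one.add ((hV.mul (hq.sub one)).mul (hV.conjTranspose hJ hJ'))

lemma frameEmbedding_eq_self {V : Matrix m κ ℂ} {T : Finset m} {A : Matrix m m ℂ}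
    (hV : Vᴴ * V = 1) (hVT : V * Vᴴ + coordFrame T * (coordFrame T)ᴴ = 1) (hA : Aᴴ * A = 1)
    (hAT : A * coordFrame T = coordFrame T) :
    frameEmbedding V (Vᴴ * A * V) = A := by
  have h1 : (A - 1) * (coordFrame T * (coordFrame T)ᴴ) = 0 := by
    rw [sub_mul, one_mul, ← Matrix.mul_assoc, hAT, sub_self]
  have h2 : (coordFrame T * (coordFrame T)ᴴ) * (A - 1) = 0 := by
    have : (coordFrame T)ᴴ * A = (coordFrame T)ᴴ := by
      rw [← hAT, conjTranspose_mul, Matrix.mul_assoc, hA, Matrix.mul_one, ← conjTranspose_mul, hAT]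
    rw [mul_sub, mul_one, Matrix.mul_assoc, this, sub_self]
  have h3 : V * (Vᴴ * A * V - 1) * Vᴴ = V * Vᴴ * (A - 1) * (V * Vᴴ) := by
    calc _ = V * (Vᴴ * A * V - Vᴴ * V) * Vᴴ := by rw [hV]
      _ = _ := by simp only [Matrix.mul_sub, Matrix.sub_mul, Matrix.mul_assoc, Matrix.one_mul]
  rw [frameEmbedding, h3, eq_sub_of_add_eq hVT, sub_mul 1, h2, sub_zero, one_mul, mul_sub, h1,
    sub_zero, mul_one, add_sub_cancel]

lemma conjTranspose_submatrix_one_mul_self {τ : Type*} [DecidableEq τ] {c : τ → m}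
    (hc : Function.Injective c) :
    ((1 : Matrix m m ℂ).submatrix id c)ᴴ * (1 : Matrix m m ℂ).submatrix id c = 1 := by
  ext i j
  simp [Matrix.mul_apply, Matrix.one_apply, hc.eq_iff]

end FrameEmbedding

section Generators

lemma intertwines_suInclusion (q : SU 2) : Intertwines quatForm quatForm (suInclusion 2 q) := by
  have h1 : (suInclusion 2 q)ᴴ = adjugate (suInclusion 2 q) := by
    have h : adjugate (suInclusion 2 q) = (suInclusion 2 q)ᴴ * (suInclusion 2 q) *
        adjugate (suInclusion 2 q) := by
      rw [conjTranspose_suInclusion_mul_self, Matrix.one_mul]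
    rw [h, Matrix.mul_assoc, mul_adjugate, det_suInclusion, one_smul, Matrix.mul_one]
  rw [adjugate_fin_two] at h1
  have h2 := congrFun (congrFun h1 1) 0
  have h3 := congrFun (congrFun h1 0) 0
  simp only [conjTranspose_apply, of_apply, cons_val_zero, cons_val_one] at h2 h3
  exact intertwines_quatForm_iff.2 ⟨by rw [h2, neg_neg], h3.symm⟩

lemma det_eq_one_of_intertwines {q : Matrix (Fin 2) (Fin 2) ℂ} (h : qᴴ * q = 1)
    (hq : Intertwines quatForm quatForm q) : q.det = 1 := by
  have h0 := congrFun (congrFun h 0) 0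
  rw [hq.det_eq]
  simp only [Matrix.mul_apply, conjTranspose_apply, Fin.sum_univ_two, one_apply_eq] at h0
  rw [← h0]
  push_cast
  rw [← Complex.conj_mul', ← Complex.conj_mul']
  rfl

/-- The embedding of `SU(2)` in `SU(n)` given by two distinct coordinates. -/
def suEmbedding (c : Fin 2 → Fin n) (hc : Function.Injective c) : C(SU 2, SU n) where
  toFun q := SU.ofMatrix (frameEmbedding ((1 : Matrix (Fin n) (Fin n) ℂ).submatrix id c)
      (suInclusion 2 q))
    (conjTranspose_frameEmbedding_mul_self (conjTranspose_submatrix_one_mul_self hc)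
      (conjTranspose_suInclusion_mul_self q))
    (by rw [det_frameEmbedding (conjTranspose_submatrix_one_mul_self hc), det_suInclusion])
  continuous_toFun := by
    rw [(isInducing_suInclusion n).continuous_iff]
    have := (isInducing_suInclusion 2).continuous
    change Continuous fun q => frameEmbedding ((1 : Matrix (Fin n) (Fin n) ℂ).submatrix id c)
      (suInclusion 2 q)
    unfold frameEmbedding
    exact continuous_const.add ((continuous_const.matrix_mul
      (this.sub continuous_const)).matrix_mul continuous_const)

lemma suInclusion_suEmbedding (c : Fin 2 → Fin n) (hc : Function.Injective c) (q : SU 2) :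
    suInclusion n (suEmbedding c hc q) =
      frameEmbedding ((1 : Matrix (Fin n) (Fin n) ℂ).submatrix id c) (suInclusion 2 q) := rfl

lemma suEmbedding_one (c : Fin 2 → Fin n) (hc : Function.Injective c) :
    suEmbedding c hc 1 = 1 := by
  apply suInclusion_injective
  rw [suInclusion_suEmbedding, map_one, map_one, frameEmbedding_one]

/-- The unit sphere in `ℂ^(n ⊕ n)`. -/
abbrev quatSphere (n : ℕ) : Set (EuclideanSpace ℂ (Fin n ⊕ Fin n)) := Metric.sphere 0 1

lemma conjTranspose_quatFrame_mul_self_of_sphere (v : quatSphere n) :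
    (quatFrame v.1.ofLp)ᴴ * quatFrame v.1.ofLp = 1 := by
  have h : star v.1.ofLp ⬝ᵥ v.1.ofLp = inner ℂ v.1 v.1 := by
    rw [EuclideanSpace.inner_eq_star_dotProduct, dotProduct_comm]
  have hv : ‖v.1‖ = 1 := by simp
  rw [conjTranspose_quatFrame_mul_self, h, inner_self_eq_norm_sq_to_K, hv]
  simp

/-- The embedding of `SU(2)` in `Sp(2n)` given by a unit vector. -/
def spFamily (n : ℕ) : C(quatSphere n × SU 2, Sp n) where
  toFun p := ⟨⟨frameEmbedding (quatFrame p.1.1.ofLp) (suInclusion 2 p.2),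
    mem_unitaryGroup_iff'.2 (conjTranspose_frameEmbedding_mul_self
      (conjTranspose_quatFrame_mul_self_of_sphere p.1) (conjTranspose_suInclusion_mul_self p.2))⟩,
    mem_Sp_iff.2 (Intertwines.frameEmbedding (transpose_Jmat n) transpose_quatForm
      (intertwines_quatFrame _) (intertwines_suInclusion p.2))⟩
  continuous_toFun := by
    rw [(isInducing_spInclusion n).continuous_iff]
    have h1 : Continuous fun p : quatSphere n × SU 2 => suInclusion 2 p.2 :=
      (isInducing_suInclusion 2).continuous.comp continuous_snd
    have h2 : Continuous fun p : quatSphere n × SU 2 => quatFrame p.1.1.ofLp :=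
      continuous_quatFrame.comp (by fun_prop)
    change Continuous fun p : quatSphere n × SU 2 =>
      frameEmbedding (quatFrame p.1.1.ofLp) (suInclusion 2 p.2)
    unfold frameEmbedding
    exact continuous_const.add ((h2.matrix_mul
      (h1.sub continuous_const)).matrix_mul h2.matrix_conjTranspose)

lemma spInclusion_spFamily (v : quatSphere n) (q : SU 2) :
    spInclusion n (spFamily n (v, q)) = frameEmbedding (quatFrame v.1.ofLp) (suInclusion 2 q) :=
  rfl

lemma spFamily_one (v : quatSphere n) : spFamily n (v, 1) = 1 := by
  apply spInclusion_injective
  rw [spInclusion_spFamily, map_one, map_one, frameEmbedding_one]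

/-- The embedding of `SU(2)` in `Sp(2n)` given by the unit vector `v`. -/
def quatEmbedding (v : quatSphere n) : C(SU 2, Sp n) :=
  (spFamily n).comp ((ContinuousMap.const _ v).prodMk (ContinuousMap.id _))

lemma quatEmbedding_one (v : quatSphere n) : quatEmbedding v 1 = 1 := spFamily_one v

lemma spInclusion_quatEmbedding (v : quatSphere n) (q : SU 2) :
    spInclusion n (quatEmbedding v q) = frameEmbedding (quatFrame v.1.ofLp) (suInclusion 2 q) :=
  rfl

lemma homotopic_quatEmbedding [NeZero n] {ι : Type*} (v w : quatSphere n) (f : Ω^ ι (SU 2) 1) :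
    GenLoop.Homotopic (GenLoop.map (quatEmbedding v) (quatEmbedding_one v) f)
      (GenLoop.map (quatEmbedding w) (quatEmbedding_one w) f) := by
  have hrank : 1 < Module.rank ℝ (EuclideanSpace ℂ (Fin n ⊕ Fin n)) := by
    rw [← Module.finrank_eq_rank, finrank_real_euclideanSpace_complex]
    have := NeZero.pos n
    simp
    norm_cast
    omega
  have hpc := isPathConnected_sphere hrank (0 : EuclideanSpace ℂ (Fin n ⊕ Fin n)) zero_le_one
  rw [isPathConnected_iff_pathConnectedSpace] at hpc
  obtain ⟨γ⟩ := hpc.joined v w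
  refine GenLoop.homotopic_of_family
    ⟨fun p => spFamily n (γ p.1, f p.2), by
      refine (spFamily n).continuous.comp ?_
      exact (γ.continuous.comp continuous_fst).prodMk (f.1.continuous.comp continuous_snd)⟩
    (fun y => ?_) (fun y => ?_) fun u y hy => ?_
  · change spFamily n (γ 0, f y) = spFamily n (v, f y)
    rw [γ.source]
  · change spFamily n (γ 1, f y) = spFamily n (w, f y)
    rw [γ.target]
  · change spFamily n (γ u, f y) = 1
    rw [GenLoop.boundary f y hy, spFamily_one]

end Generators

section Surjectivity

lemma conjTranspose_compress_mul_self {m κ : Type*} [Fintype m] [DecidableEq m] [Fintype κ]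
    [DecidableEq κ] {V : Matrix m κ ℂ} {A : Matrix m m ℂ} (hV : Vᴴ * V = 1) (hA : Aᴴ * A = 1)
    (h : frameEmbedding V (Vᴴ * A * V) = A) :
    (Vᴴ * A * V)ᴴ * (Vᴴ * A * V) = 1 := by
  have h1 : V * (Vᴴ * A * V) = A * V := by rw [← frameEmbedding_mul_frame hV, h]
  calc _ = (Vᴴ * A * V)ᴴ * (Vᴴ * V) * (Vᴴ * A * V) := by rw [hV, Matrix.mul_one]
    _ = (V * (Vᴴ * A * V))ᴴ * (V * (Vᴴ * A * V)) := by
      simp only [conjTranspose_mul, Matrix.mul_assoc]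
    _ = Vᴴ * (Aᴴ * A) * V := by
      rw [h1]
      simp only [conjTranspose_mul, Matrix.mul_assoc]
    _ = 1 := by rw [hA, Matrix.mul_one, hV]

/-- Compressing a loop of unitary matrices to the span of a frame gives a loop in `SU(2)`. -/
lemma exists_genLoop_compress {m : Type*} [Fintype m] [DecidableEq m] {ι : Type*}
    {V : Matrix m (Fin 2) ℂ} (hV : Vᴴ * V = 1) {A : (ι → unitInterval) → Matrix m m ℂ}
    (hA : Continuous A) (hA₁ : ∀ t ∈ Cube.boundary ι, A t = 1)
    (h : ∀ t, (Vᴴ * A t * V)ᴴ * (Vᴴ * A t * V) = 1) (hdet : ∀ t, (Vᴴ * A t * V).det = 1) :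
    ∃ u : Ω^ ι (SU 2) 1, ∀ t, suInclusion 2 (u t) = Vᴴ * A t * V := by
  refine ⟨⟨⟨fun t => SU.ofMatrix _ (h t) (hdet t), ?_⟩, fun t ht => ?_⟩, fun t => rfl⟩
  · rw [(isInducing_suInclusion 2).continuous_iff]
    exact (continuous_const.matrix_mul hA).matrix_mul continuous_const
  · apply suInclusion_injective
    change Vᴴ * A t * V = _
    rw [hA₁ t ht, Matrix.mul_one, hV, map_one]

lemma exists_homotopic_map_suEmbedding (c : Fin 2 → Fin n) (hc : Function.Injective c)
    (f : Ω^ (Fin 3) (SU n) 1) :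
    ∃ u : Ω^ (Fin 3) (SU 2) 1,
      GenLoop.Homotopic f (GenLoop.map (suEmbedding c hc) (suEmbedding_one c hc) u) := by
  have h01 : c 0 ≠ c 1 := hc.ne zero_ne_one
  obtain ⟨g, hg, hgS⟩ := exists_homotopic_SU h01 f (S := {c 0, c 1}ᶜ) (by simp) (by simp)
  have hV := conjTranspose_submatrix_one_mul_self hc
  set V := (1 : Matrix (Fin n) (Fin n) ℂ).submatrix id c with hVdef
  have hE (t) : frameEmbedding V (Vᴴ * suInclusion n (g t) * V) = suInclusion n (g t) :=
    frameEmbedding_eq_self hV (submatrix_one_mul_conjTranspose_add h01 (by simp))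
      (conjTranspose_suInclusion_mul_self _) (hgS t)
  obtain ⟨u, hu⟩ := exists_genLoop_compress hV (A := fun t => suInclusion n (g t))
    ((isInducing_suInclusion n).continuous.comp g.1.continuous)
    (fun t ht => by rw [GenLoop.boundary g t ht, map_one])
    (fun t => conjTranspose_compress_mul_self hV (conjTranspose_suInclusion_mul_self _) (hE t))
    (fun t => by rw [← det_frameEmbedding hV, hE, det_suInclusion])
  refine ⟨u, hg.trans (Eq.subst ?_ (GenLoop.Homotopic.refl g))⟩
  refine GenLoop.ext _ _ fun t => suInclusion_injective n ?_
  rw [GenLoop.map_apply, suInclusion_suEmbedding, hu, ← hVdef, hE]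

/-- The unit vector on the first coordinate indexed by `k`. -/
def coordQuat (k : Fin n) : quatSphere n :=
  ⟨EuclideanSpace.single (Sum.inl k) 1, by simp⟩

lemma quatFrame_coordQuat (k : Fin n) : quatFrame (coordQuat k).1.ofLp =
    (1 : Matrix (Fin n ⊕ Fin n) (Fin n ⊕ Fin n) ℂ).submatrix id ![Sum.inl k, Sum.inr k] := by
  rw [← quatFrame_one_col]
  congr 1
  ext j
  simp [coordQuat, Matrix.one_apply]

lemma exists_homotopic_map_quatEmbedding (k : Fin n) (f : Ω^ (Fin 3) (Sp n) 1) :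
    ∃ u : Ω^ (Fin 3) (SU 2) 1, GenLoop.Homotopic f
      (GenLoop.map (quatEmbedding (coordQuat k)) (quatEmbedding_one _) u) := by
  obtain ⟨g, hg, hgS⟩ := exists_homotopic_Sp_of_notMem f (S := {k}ᶜ) (k₀ := k) (by simp)
  have hV := conjTranspose_quatFrame_mul_self_of_sphere (coordQuat k)
  have hVT := submatrix_one_mul_conjTranspose_add (m := Fin n ⊕ Fin n)
    (c := ![Sum.inl k, Sum.inr k]) (T := Finset.disjSum {k}ᶜ {k}ᶜ) (by simp) (by simp)
  rw [← quatFrame_coordQuat] at hVT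
  have hVJ := intertwines_quatFrame (coordQuat k).1.ofLp
  set V := quatFrame (coordQuat k).1.ofLp with hVdef
  have hE (t) : frameEmbedding V (Vᴴ * spInclusion n (g t) * V) = spInclusion n (g t) :=
    frameEmbedding_eq_self hV hVT (conjTranspose_spInclusion_mul_self _) (hgS t)
  have hU (t) := conjTranspose_compress_mul_self hV (conjTranspose_spInclusion_mul_self _) (hE t)
  obtain ⟨u, hu⟩ := exists_genLoop_compress hV (A := fun t => spInclusion n (g t))
    ((isInducing_spInclusion n).continuous.comp g.1.continuous)
    (fun t ht => by rw [GenLoop.boundary g t ht, map_one]) hU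
    (fun t => det_eq_one_of_intertwines (hU t)
      (((hVJ.conjTranspose (transpose_Jmat n) transpose_quatForm).mul
        (mem_range_spInclusion_iff.1 ⟨g t, rfl⟩).2).mul hVJ))
  refine ⟨u, hg.trans (Eq.subst ?_ (GenLoop.Homotopic.refl g))⟩
  refine GenLoop.ext _ _ fun t => spInclusion_injective n ?_
  rw [GenLoop.map_apply, spInclusion_quatEmbedding, hu, ← hVdef, hE]

end Surjectivity

section Splitting

lemma exists_quatSphere_of_intertwines {Z : Matrix (Fin n ⊕ Fin n) (Fin 2) ℂ} (hZ : Zᴴ * Z = 1)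
    (hJ : Intertwines (Jmat n) quatForm Z) : ∃ z : quatSphere n, quatFrame z.1.ofLp = Z := by
  have h := intertwines_iff_eq_quatFrame.1 hJ
  refine ⟨⟨WithLp.toLp 2 fun k => Z k 0, ?_⟩, h.symm⟩
  rw [mem_sphere_zero_iff_norm]
  have h0 : ((Zᴴ * Z) 0 0 : ℂ) = 1 := by rw [hZ, one_apply_eq]
  have h1 : inner ℂ (WithLp.toLp 2 fun k => Z k 0) (WithLp.toLp 2 fun k => Z k 0) =
      (Zᴴ * Z) 0 0 := by
    rw [EuclideanSpace.inner_eq_star_dotProduct, dotProduct_comm]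
    rfl
  rw [h0, inner_self_eq_norm_sq_to_K] at h1
  have h2 : ‖WithLp.toLp 2 fun k => Z k 0‖ ^ 2 = 1 := Complex.ofReal_injective (by simpa using h1)
  exact (pow_eq_one_iff_of_nonneg (norm_nonneg _) two_ne_zero).1 h2

/-- A matrix in the image of `SU(2)` becomes, on passing to `Sp(2n)`, a product of two commuting
elements supported on orthogonal quaternionic lines. -/
lemma exists_spEmbedding_suEmbedding_eq_mul (c : Fin 2 → Fin n) (hc : Function.Injective c) :
    ∃ z w : quatSphere n, ∀ u, spEmbedding n (suEmbedding c hc u) =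
      quatEmbedding z u * quatEmbedding w u := by
  set X := (1 : Matrix (Fin n) (Fin n) ℂ).submatrix id c with hX
  have hXX : Xᴴ * X = 1 := conjTranspose_submatrix_one_mul_self hc
  have hXs : X.map star = X := by
    ext i j
    simp [hX, Matrix.one_apply, apply_ite]
  have hQ : quatFormᴴ * quatForm = 1 := by
    ext i j
    fin_cases i <;> fin_cases j <;> simp [quatForm, Matrix.mul_apply]
  obtain ⟨s, hs, hss⟩ : ∃ s : ℂ, star s = s ∧ s * s + s * s = 1 := by
    refine ⟨((√2)⁻¹ : ℝ), Complex.conj_ofReal _, ?_⟩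
    norm_cast
    rw [← mul_inv, Real.mul_self_sqrt zero_le_two]
    norm_num
  set L := fromRows X (0 : Matrix (Fin n) (Fin 2) ℂ) with hL
  set R := fromRows (0 : Matrix (Fin n) (Fin 2) ℂ) (X * quatForm) with hR
  have hLL : Lᴴ * L = 1 := by
    simp [hL, conjTranspose_fromRows_eq_fromCols_conjTranspose, fromCols_mul_fromRows, hXX]
  have hRR : Rᴴ * R = 1 := by
    simp only [hR, conjTranspose_fromRows_eq_fromCols_conjTranspose, fromCols_mul_fromRows,
      conjTranspose_mul, Matrix.mul_assoc]
    rw [← Matrix.mul_assoc Xᴴ, hXX]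
    simp [hQ]
  have hLR : Lᴴ * R = 0 := by
    simp [hL, hR, conjTranspose_fromRows_eq_fromCols_conjTranspose, fromCols_mul_fromRows]
  have hRL : Rᴴ * L = 0 := by
    simp [hL, hR, conjTranspose_fromRows_eq_fromCols_conjTranspose, fromCols_mul_fromRows]
  set Z := s • (L + R) with hZ
  set W := (Complex.I * s) • (L - R) with hW
  have hZZ : Zᴴ * Z = 1 := by
    simp only [hZ, conjTranspose_smul, conjTranspose_add, Matrix.smul_mul, Matrix.mul_smul,
      Matrix.add_mul, Matrix.mul_add, hLL, hRR, hLR, hRL, hs, add_zero, zero_add]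
    rw [← add_smul, smul_smul, mul_add, hss, one_smul]
  have hWW : Wᴴ * W = 1 := by
    simp only [hW, conjTranspose_smul, conjTranspose_sub, Matrix.smul_mul, Matrix.mul_smul,
      Matrix.sub_mul, Matrix.mul_sub, hLL, hRR, hLR, hRL, hs, star_mul', sub_zero, zero_sub]
    rw [smul_neg, sub_neg_eq_add, ← add_smul, smul_smul]
    convert one_smul ℂ (1 : Matrix (Fin 2) (Fin 2) ℂ)
    rw [Complex.star_def, Complex.conj_I]
    linear_combination hss - 2 * s * s * Complex.I_mul_I
  have hZW : Zᴴ * W = 0 := by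
    simp [hZ, hW, conjTranspose_add, Matrix.smul_mul, Matrix.mul_smul,
      Matrix.add_mul, Matrix.mul_sub, hLL, hRR, hLR, hRL]
  have hXs' (i : Fin n) (j : Fin 2) : (starRingEnd ℂ) (X i j) = X i j :=
    congrFun (congrFun hXs i) j
  have hs' : (starRingEnd ℂ) s = s := hs
  have hZJ : Intertwines (Jmat n) quatForm Z := by
    rw [intertwines_iff_eq_quatFrame]
    ext k j
    fin_cases j <;> rcases k with k | k <;>
      simp [hZ, hL, hR, Matrix.mul_apply, Fin.sum_univ_two, quatForm, hXs', hs']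
  have hWJ : Intertwines (Jmat n) quatForm W := by
    rw [intertwines_iff_eq_quatFrame]
    ext k j
    fin_cases j <;> rcases k with k | k <;>
      simp [hW, hL, hR, Matrix.mul_apply, Fin.sum_univ_two, quatForm, hXs', hs']
  obtain ⟨z, hz⟩ := exists_quatSphere_of_intertwines hZZ hZJ
  obtain ⟨w, hw⟩ := exists_quatSphere_of_intertwines hWW hWJ
  refine ⟨z, w, fun u => spInclusion_injective n ?_⟩
  rw [map_mul, spInclusion_quatEmbedding, spInclusion_quatEmbedding, hz, hw,
    frameEmbedding_mul_of_orthogonal hZW]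
  set p := suInclusion 2 u - 1 with hp
  have hpJ : quatForm * p * quatFormᴴ = p.map star := by
    have h : quatForm * p = p.map star * quatForm := (intertwines_suInclusion u).sub Intertwines.one
    rw [h, Matrix.mul_assoc, mul_eq_one_comm.1 hQ, Matrix.mul_one]
  have hsum : Z * p * Zᴴ + W * p * Wᴴ = L * p * Lᴴ + R * p * Rᴴ := by
    have hII : Complex.I * s * (star Complex.I * s) = s * s := by
      rw [Complex.star_def, Complex.conj_I]
      linear_combination -s * s * Complex.I_mul_I
    have hZp : Z * p * Zᴴ = (s * s) • ((L + R) * p * (L + R)ᴴ) := by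
      rw [hZ, conjTranspose_smul, Matrix.smul_mul, Matrix.smul_mul, Matrix.mul_smul, smul_smul, hs]
    have hWp : W * p * Wᴴ = (s * s) • ((L - R) * p * (L - R)ᴴ) := by
      rw [hW, conjTranspose_smul, Matrix.smul_mul, Matrix.smul_mul, Matrix.mul_smul, smul_smul,
        star_mul', hs, hII]
    rw [hZp, hWp, ← one_smul ℂ (L * p * Lᴴ + R * p * Rᴴ), ← hss]
    simp only [conjTranspose_add, conjTranspose_sub, Matrix.add_mul, Matrix.mul_add,
      Matrix.sub_mul, Matrix.mul_sub]
    module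
  have hRp : R * p * Rᴴ = fromBlocks 0 0 0 (X * p.map star * Xᴴ) := by
    rw [hR, conjTranspose_fromRows_eq_fromCols_conjTranspose, fromRows_mul,
      fromRows_mul_fromCols, ← hpJ]
    simp [Matrix.mul_assoc]
  have hLp : L * p * Lᴴ = fromBlocks (X * p * Xᴴ) 0 0 0 := by
    rw [hL, conjTranspose_fromRows_eq_fromCols_conjTranspose, fromRows_mul, fromRows_mul_fromCols]
    simp
  have hconj : (frameEmbedding X (suInclusion 2 u)).map (starRingEnd ℂ) =
      1 + X * p.map star * Xᴴ := by
    have h1 (A B : Matrix (Fin n) (Fin n) ℂ) : (A + B).map (starRingEnd ℂ) =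
      A.map (starRingEnd ℂ) + B.map (starRingEnd ℂ) := Matrix.map_add _ (map_add _) _ _
    have h2 : Xᴴ.map (starRingEnd ℂ) = Xᴴ := congrArg conjTranspose hXs
    rw [frameEmbedding, h1, Matrix.map_mul, Matrix.map_mul, h2,
      Matrix.map_one _ (map_zero _) (map_one _)]
    exact congrArg (fun Y => 1 + Y * p.map star * Xᴴ) hXs
  rw [add_assoc, hsum, hLp, hRp]
  change fromBlocks (frameEmbedding X (suInclusion 2 u)) 0 0
    ((frameEmbedding X (suInclusion 2 u)).map (starRingEnd ℂ)) = _
  rw [hconj, fromBlocks_add, ← fromBlocks_one, fromBlocks_add, frameEmbedding]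
  simp [hp]

end Splitting

/-- **Instantons in Partially Broken Gauge Groups**: for `N ≥ 2`, the image of
`π₃(SU(N)) → π₃(Sp(2N))` induced by the embedding `U ↦ diag(U, conj U)` is the subgroup of
squares of `π₃(Sp(2N))` (the index of embedding is two). -/
theorem range_induced_pi3_SU_to_Sp (N : ℕ) (hN : 2 ≤ N) :
    Set.range (HomotopyGroup.induced (Fin 3) (spEmbedding N) (spEmbedding_one N)) =
      Set.range fun x : π_ 3 (↥(Sp N)) 1 => x ^ 2 := by
  have : NeZero N := ⟨by omega⟩
  let a : Fin N := ⟨0, by omega⟩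
  let b : Fin N := ⟨1, by omega⟩
  have hc : Function.Injective ![a, b] := by
    intro i j
    fin_cases i <;> fin_cases j <;> simp [a, b]
  obtain ⟨z, w, hzw⟩ := exists_spEmbedding_suEmbedding_eq_mul ![a, b] hc
  have key (u : Ω^ (Fin 3) (SU 2) 1) :
      HomotopyGroup.induced (Fin 3) (spEmbedding N) (spEmbedding_one N)
        (HomotopyGroup.mk (GenLoop.map (suEmbedding ![a, b] hc) (suEmbedding_one _ hc) u)) =
      HomotopyGroup.mk (GenLoop.map (quatEmbedding (coordQuat a)) (quatEmbedding_one _) u) ^ 2 := by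
    rw [pow_two]
    nth_rewrite 1 [HomotopyGroup.mk_eq_iff.2 (homotopic_quatEmbedding (coordQuat a) z u)]
    rw [HomotopyGroup.mk_eq_iff.2 (homotopic_quatEmbedding (coordQuat a) w u),
      ← HomotopyGroup.mk_pointwiseMul]
    exact congrArg HomotopyGroup.mk (GenLoop.ext _ _ fun t => hzw (u t))
  apply Set.Subset.antisymm
  · rintro _ ⟨x, rfl⟩
    obtain ⟨f, rfl⟩ : ∃ f, HomotopyGroup.mk f = x := Quotient.exists_rep x
    obtain ⟨u, hu⟩ := exists_homotopic_map_suEmbedding ![a, b] hc f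
    rw [HomotopyGroup.mk_eq_iff.2 hu, key]
    exact ⟨_, rfl⟩
  · rintro _ ⟨x, rfl⟩
    obtain ⟨f, rfl⟩ : ∃ f, HomotopyGroup.mk f = x := Quotient.exists_rep x
    obtain ⟨u, hu⟩ := exists_homotopic_map_quatEmbedding a f
    exact ⟨_, (key u).trans (congrArg (· ^ 2) (HomotopyGroup.mk_eq_iff.2 hu).symm)⟩

end
end

section
/- Let ρ > 0 and v ∈ ℝ, write a point of ℝ⁴ as (t, x, y, z) and s = t² + x² + y² + z² + ρ², let A₀, A₁, A₂, A₃ : ℝ⁴ → M₂(ℂ) be the one-instanton configuration A₀ = (1/s)·[[−z, −x+iy],[−x−iy, z]], A₁ = (1/s)·[[y, t+iz],[t−iz, −y]], A₂ = (1/s)·[[−x, −it+z],[it+z, x]], A₃ = (1/s)·[[t, −ix−y],[ix−y, −t]], and let H : ℝ⁴ → M₂(ℂ) be H = (v/s)·[[(t+iz)² − (x−iy)², 2i(tx − yz)],[2i(tx − yz), (t−iz)² − (x+iy)²]], with covariant derivative D_μ H = ∂_μ H − i A_μ H − i H A_μᵀ. Then the action of the Higgs field, S_H = ∫_{ℝ⁴}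 ∑_{μ=0}^{3} Tr((D_μ H)† (D_μ H)) d⁴x, equals 8π²ρ²v². -/
open Matrix

/-- The partial derivative `∂_μ` of a matrix-valued function on `ℝ⁴`, taken entrywise. -/
noncomputable def pderiv {m : Type*} (μ : Fin 4)
    (A : (Fin 4 → ℝ) → Matrix m m ℂ) (p : Fin 4 → ℝ) : Matrix m m ℂ :=
  Matrix.of fun i j => fderiv ℝ (fun q => A q i j) p (Pi.single μ 1)

/-- The covariant derivative `D_μ K = ∂_μ K − i A_μ K − i K A_μᵀ` of a field `K` in the
rank-two symmetric tensor representation. -/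
noncomputable def Dcov {m : Type*} [Fintype m]
    (A : Fin 4 → (Fin 4 → ℝ) → Matrix m m ℂ) (μ : Fin 4)
    (K : (Fin 4 → ℝ) → Matrix m m ℂ) : (Fin 4 → ℝ) → Matrix m m ℂ :=
  fun p => pderiv μ K p - Complex.I • (A μ p * K p) - Complex.I • (K p * (A μ p)ᵀ)

/-- `s = t² + x² + y² + z² + ρ²` for `(t,x,y,z) ∈ ℝ⁴`. -/
def sdenom (ρ : ℝ) (p : Fin 4 → ℝ) : ℝ :=
  p 0 ^ 2 + p 1 ^ 2 + p 2 ^ 2 + p 3 ^ 2 + ρ ^ 2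

/-- The BPST one-instanton configuration of size `ρ`, with `(t,x,y,z) = (p 0, p 1, p 2, p 3)`. -/
noncomputable def bpst (ρ : ℝ) : Fin 4 → (Fin 4 → ℝ) → Matrix (Fin 2) (Fin 2) ℂ :=
  ![fun p => ((sdenom ρ p : ℂ))⁻¹ •
      !![-(p 3 : ℂ), -(p 1 : ℂ) + (p 2 : ℂ) * Complex.I;
         -(p 1 : ℂ) - (p 2 : ℂ) * Complex.I, (p 3 : ℂ)],
    fun p => ((sdenom ρ p : ℂ))⁻¹ •
      !![(p 2 : ℂ), (p 0 : ℂ) + (p 3 : ℂ) * Complex.I;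
         (p 0 : ℂ) - (p 3 : ℂ) * Complex.I, -(p 2 : ℂ)],
    fun p => ((sdenom ρ p : ℂ))⁻¹ •
      !![-(p 1 : ℂ), -(p 0 : ℂ) * Complex.I + (p 3 : ℂ);
         (p 0 : ℂ) * Complex.I + (p 3 : ℂ), (p 1 : ℂ)],
    fun p => ((sdenom ρ p : ℂ))⁻¹ •
      !![(p 0 : ℂ), -(p 1 : ℂ) * Complex.I - (p 2 : ℂ);
         (p 1 : ℂ) * Complex.I - (p 2 : ℂ), -(p 0 : ℂ)]]

/-- The Higgs field configuration in the rank-two symmetric tensor representation of `SU(2)`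
under the BPST one-instanton background, with `(t,x,y,z) = (p 0, p 1, p 2, p 3)`. -/
noncomputable def higgs (ρ v : ℝ) (p : Fin 4 → ℝ) : Matrix (Fin 2) (Fin 2) ℂ :=
  ((v : ℂ) / (sdenom ρ p : ℂ)) •
    !![((p 0 : ℂ) + (p 3 : ℂ) * Complex.I) ^ 2 - ((p 1 : ℂ) - (p 2 : ℂ) * Complex.I) ^ 2,
       2 * Complex.I * ((p 0 : ℂ) * (p 1 : ℂ) - (p 2 : ℂ) * (p 3 : ℂ));
       2 * Complex.I * ((p 0 : ℂ) * (p 1 : ℂ) - (p 2 : ℂ) * (p 3 : ℂ)),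
       ((p 0 : ℂ) - (p 3 : ℂ) * Complex.I) ^ 2 - ((p 1 : ℂ) + (p 2 : ℂ) * Complex.I) ^ 2]

open MeasureTheory

/-- The numerator of the Higgs field, a quadratic polynomial in the coordinates. -/
noncomputable def higgsNumerator (p : Fin 4 → ℝ) : Matrix (Fin 2) (Fin 2) ℂ :=
  !![((p 0 : ℂ) + (p 3 : ℂ) * Complex.I) ^ 2 - ((p 1 : ℂ) - (p 2 : ℂ) * Complex.I) ^ 2,
     2 * Complex.I * ((p 0 : ℂ) * (p 1 : ℂ) - (p 2 : ℂ) * (p 3 : ℂ));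
     2 * Complex.I * ((p 0 : ℂ) * (p 1 : ℂ) - (p 2 : ℂ) * (p 3 : ℂ)),
     ((p 0 : ℂ) - (p 3 : ℂ) * Complex.I) ^ 2 - ((p 1 : ℂ) + (p 2 : ℂ) * Complex.I) ^ 2]

/-- The partial derivatives of `higgsNumerator`. -/
noncomputable def higgsNumeratorDeriv (p : Fin 4 → ℝ) : Fin 4 → Matrix (Fin 2) (Fin 2) ℂ :=
  ![!![2 * ((p 0 : ℂ) + (p 3 : ℂ) * Complex.I), 2 * Complex.I * (p 1 : ℂ);
       2 * Complex.I * (p 1 : ℂ), 2 * ((p 0 : ℂ) - (p 3 : ℂ) * Complex.I)],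
    !![-2 * ((p 1 : ℂ) - (p 2 : ℂ) * Complex.I), 2 * Complex.I * (p 0 : ℂ);
       2 * Complex.I * (p 0 : ℂ), -2 * ((p 1 : ℂ) + (p 2 : ℂ) * Complex.I)],
    !![2 * Complex.I * ((p 1 : ℂ) - (p 2 : ℂ) * Complex.I), -2 * Complex.I * (p 3 : ℂ);
       -2 * Complex.I * (p 3 : ℂ), -2 * Complex.I * ((p 1 : ℂ) + (p 2 : ℂ) * Complex.I)],
    !![2 * Complex.I * ((p 0 : ℂ) + (p 3 : ℂ) * Complex.I), -2 * Complex.I * (p 2 : ℂ);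
       -2 * Complex.I * (p 2 : ℂ), -2 * Complex.I * ((p 0 : ℂ) - (p 3 : ℂ) * Complex.I)]]

lemma hasFDerivAt_coord (i : Fin 4) (p : Fin 4 → ℝ) :
    HasFDerivAt (fun q : Fin 4 → ℝ => (q i : ℂ))
      (Complex.ofRealCLM.comp (ContinuousLinearMap.proj i)) p :=
  Complex.ofRealCLM.hasFDerivAt.comp p (hasFDerivAt_apply i p)

lemma sdenom_pos {ρ : ℝ} (hρ : 0 < ρ) (p : Fin 4 → ℝ) : 0 < sdenom ρ p := by
  unfold sdenom
  positivity

lemma differentiable_higgsNumerator (i j : Fin 2) :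
    Differentiable ℝ fun q => higgsNumerator q i j := by
  intro p
  fin_cases i <;> fin_cases j <;> simp [higgsNumerator] <;> fun_prop

lemma pderiv_higgsNumerator (μ : Fin 4) (p : Fin 4 → ℝ) :
    pderiv μ higgsNumerator p = higgsNumeratorDeriv p μ := by
  have h := fun k => hasFDerivAt_coord k p
  have h₀₀ := (((h 0).add ((h 3).mul_const Complex.I)).pow 2).sub
    (((h 1).sub ((h 2).mul_const Complex.I)).pow 2)
  have h₀₁ := (((h 0).mul (h 1)).sub ((h 2).mul (h 3))).const_mul (2 * Complex.I)
  have h₁₁ := (((h 0).sub ((h 3).mul_const Complex.I)).pow 2).sub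
    (((h 1).add ((h 2).mul_const Complex.I)).pow 2)
  ext i j
  fin_cases i <;> fin_cases j
  · refine (congrArg (· (Pi.single μ 1)) h₀₀.fderiv).trans ?_
    fin_cases μ <;> simp [higgsNumeratorDeriv] <;> ring_nf
  · refine (congrArg (· (Pi.single μ 1)) h₀₁.fderiv).trans ?_
    fin_cases μ <;> simp [higgsNumeratorDeriv]
  · refine (congrArg (· (Pi.single μ 1)) h₀₁.fderiv).trans ?_
    fin_cases μ <;> simp [higgsNumeratorDeriv]
  · refine (congrArg (· (Pi.single μ 1)) h₁₁.fderiv).trans ?_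
    fin_cases μ <;> simp [higgsNumeratorDeriv] <;> ring_nf

lemma hasFDerivAt_sdenom (ρ : ℝ) (p : Fin 4 → ℝ) :
    ∃ L : (Fin 4 → ℝ) →L[ℝ] ℂ, HasFDerivAt (fun q => (sdenom ρ q : ℂ)) L p ∧
      ∀ μ, L (Pi.single μ 1) = 2 * (p μ : ℂ) := by
  have h := fun k => (hasFDerivAt_coord k p).pow 2
  have H := ((((h 0).add (h 1)).add (h 2)).add (h 3)).add_const ((ρ : ℂ) ^ 2)
  refine ⟨_, H.congr_of_eventuallyEq (.of_forall fun q => by simp [sdenom]), fun μ => ?_⟩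
  fin_cases μ <;> simp

lemma pderiv_higgs {ρ : ℝ} (hρ : 0 < ρ) (v : ℝ) (μ : Fin 4) (p : Fin 4 → ℝ) :
    pderiv μ (higgs ρ v) p = ((v : ℂ) / (sdenom ρ p : ℂ)) • higgsNumeratorDeriv p μ -
      ((v : ℂ) * (2 * p μ) / (sdenom ρ p : ℂ) ^ 2) • higgsNumerator p := by
  obtain ⟨L, hL, hLμ⟩ := hasFDerivAt_sdenom ρ p
  have hs : (sdenom ρ p : ℂ) ≠ 0 := by exact_mod_cast (sdenom_pos hρ p).ne'
  rw [← pderiv_higgsNumerator]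
  ext i j
  have H := (((hasFDerivAt_inv' (𝕜 := ℝ) hs).comp p hL).const_mul (v : ℂ)).mul
    (differentiable_higgsNumerator i j p).hasFDerivAt
  refine (congrArg (· (Pi.single μ 1)) (H.congr_of_eventuallyEq
    (f₁ := fun q => higgs ρ v q i j) (.of_forall fun q => ?_)).fderiv).trans ?_
  · simp [higgs, higgsNumerator, div_eq_mul_inv]
  · simp [hLμ, pderiv]
    field_simp
    ring

/-- The covariant derivative of the Higgs field is a rescaling of the ordinary derivative of its
numerator. -/
lemma Dcov_bpst_higgs {ρ : ℝ} (hρ : 0 < ρ) (v : ℝ) (μ : Fin 4) (p : Fin 4 → ℝ) :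
    Dcov (bpst ρ) μ (higgs ρ v) p =
      ((v * ρ ^ 2 / sdenom ρ p ^ 2 : ℝ) : ℂ) • higgsNumeratorDeriv p μ := by
  have hs : (sdenom ρ p : ℂ) ≠ 0 := by exact_mod_cast (sdenom_pos hρ p).ne'
  have hS : (sdenom ρ p : ℂ) = (p 0 : ℂ) ^ 2 + (p 1 : ℂ) ^ 2 + (p 2 : ℂ) ^ 2 + (p 3 : ℂ) ^ 2 +
      (ρ : ℂ) ^ 2 := by simp [sdenom]
  have hI : Complex.I ^ 2 = -1 := Complex.I_sq
  rw [Dcov, pderiv_higgs hρ]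
  ext i j
  fin_cases μ <;> fin_cases i <;> fin_cases j <;>
    simp [bpst, higgs, higgsNumerator, higgsNumeratorDeriv, Matrix.vecMul, Matrix.vecHead,
      Matrix.vecTail] <;>
    field_simp <;> rw [hS] <;> grind

lemma sum_trace_higgsNumeratorDeriv (p : Fin 4 → ℝ) :
    ∑ μ, ((higgsNumeratorDeriv p μ)ᴴ * higgsNumeratorDeriv p μ).trace =
      ((24 * (p 0 ^ 2 + p 1 ^ 2 + p 2 ^ 2 + p 3 ^ 2) : ℝ) : ℂ) := by
  have hI : Complex.I ^ 2 = -1 := Complex.I_sq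
  have h2 : (starRingEnd ℂ) 2 = 2 := map_ofNat _ 2
  simp [h2, Fin.sum_univ_four, Matrix.trace, higgsNumeratorDeriv, Matrix.mul_apply]
  grind

lemma higgs_action_density {ρ : ℝ} (hρ : 0 < ρ) (v : ℝ) (p : Fin 4 → ℝ) :
    (∑ μ : Fin 4,
      ((Dcov (bpst ρ) μ (higgs ρ v) p)ᴴ * Dcov (bpst ρ) μ (higgs ρ v) p).trace).re =
      24 * v ^ 2 * ρ ^ 4 *
        ((p 0 ^ 2 + p 1 ^ 2 + p 2 ^ 2 + p 3 ^ 2) / sdenom ρ p ^ 4) := by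
  simp only [Dcov_bpst_higgs hρ, Matrix.conjTranspose_smul, Matrix.smul_mul, Matrix.mul_smul,
    Matrix.trace_smul, ← Finset.smul_sum, sum_trace_higgsNumeratorDeriv]
  rw [Complex.star_def, Complex.conj_ofReal, smul_eq_mul, smul_eq_mul, ← Complex.ofReal_mul,
    ← Complex.ofReal_mul, Complex.ofReal_re]
  ring

lemma integral_radial {ρ : ℝ} (hρ : 0 < ρ) :
    ∫ r in Set.Ioi (0 : ℝ), r ^ 3 * (r ^ 2 / (r ^ 2 + ρ ^ 2) ^ 4) = 1 / (6 * ρ ^ 2) := by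
  have hd (r : ℝ) : r ^ 2 + ρ ^ 2 ≠ 0 := by positivity
  have hderiv (r : ℝ) : HasDerivAt (fun r => (r ^ 2 / (r ^ 2 + ρ ^ 2)) ^ 3 / (6 * ρ ^ 2))
      (r ^ 3 * (r ^ 2 / (r ^ 2 + ρ ^ 2) ^ 4)) r := by
    refine ((((hasDerivAt_pow 2 r).fun_div ((hasDerivAt_pow 2 r).add_const (ρ ^ 2))
      (hd r)).fun_pow 3).div_const (6 * ρ ^ 2)).congr_deriv ?_
    have := hd r
    simp only [Nat.cast_ofNat, Nat.reduceSub]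
    field_simp
    ring
  have hlim : Filter.Tendsto (fun r : ℝ => (r ^ 2 / (r ^ 2 + ρ ^ 2)) ^ 3 / (6 * ρ ^ 2))
      Filter.atTop (nhds (1 / (6 * ρ ^ 2))) := by
    have h : Filter.Tendsto (fun r : ℝ => r ^ 2 + ρ ^ 2) Filter.atTop Filter.atTop :=
      Filter.tendsto_atTop_add_const_right _ _ (Filter.tendsto_pow_atTop two_ne_zero)
    have h1 := (((h.const_div_atTop (ρ ^ 2)).const_sub 1).pow 3).div_const (6 * ρ ^ 2)
    simp only [sub_zero, one_pow] at h1
    refine h1.congr fun r => ?_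
    rw [one_sub_div (hd r), add_sub_cancel_right]
  rw [integral_Ioi_of_hasDerivAt_of_nonneg' (fun r _ => hderiv r)
    (fun r hr => by have := Set.mem_Ioi.1 hr; positivity) hlim]
  simp

lemma integral_density {ρ : ℝ} (hρ : 0 < ρ) :
    ∫ p : Fin 4 → ℝ, (p 0 ^ 2 + p 1 ^ 2 + p 2 ^ 2 + p 3 ^ 2) / sdenom ρ p ^ 4 =
      Real.pi ^ 2 / (3 * ρ ^ 2) := by
  rw [← (EuclideanSpace.volume_preserving_symm_measurableEquiv_toLp (Fin 4)).integral_comp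
    (MeasurableEquiv.measurableEmbedding _)]
  have h (q : EuclideanSpace ℝ (Fin 4)) : q 0 ^ 2 + q 1 ^ 2 + q 2 ^ 2 + q 3 ^ 2 = ‖q‖ ^ 2 := by
    simp [EuclideanSpace.norm_sq_eq, Fin.sum_univ_four]
  have hball : volume.real (Metric.ball (0 : EuclideanSpace ℝ (Fin 4)) 1) = Real.pi ^ 2 / 2 := by
    rw [Measure.real, InnerProductSpace.volume_ball_of_dim_even (k := 2) (by simp)]
    simp [Nat.factorial]
    positivity
  have hrad := integral_fun_norm_addHaar (volume : Measure (EuclideanSpace ℝ (Fin 4)))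
    (fun r => r ^ 2 / (r ^ 2 + ρ ^ 2) ^ 4)
  rw [hball] at hrad
  simp only [finrank_euclideanSpace_fin, smul_eq_mul, Nat.add_one_sub_one, integral_radial hρ,
    nsmul_eq_mul] at hrad
  simp only [sdenom]
  refine (integral_congr_ae (.of_forall fun q => ?_)).trans (hrad.trans ?_)
  · simp [← h]
  · field_simp
    norm_num

/-- **Instantons in Partially Broken Gauge Groups**, Appendix B: under the BPST one-instanton
background of size `ρ > 0`, the Euclidean action of the Higgs field configuration `H` in the
rank-two symmetric tensor representation, `S_H = ∫ ∑_μ Tr((D_μ H)† (D_μ H)) d⁴x`,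
equals `8π²ρ²v²`. -/
theorem higgs_action_eq (ρ v : ℝ) (hρ : 0 < ρ) :
    ∫ p : Fin 4 → ℝ,
        (∑ μ : Fin 4,
          ((Dcov (bpst ρ) μ (higgs ρ v) p)ᴴ * Dcov (bpst ρ) μ (higgs ρ v) p).trace).re =
      8 * Real.pi ^ 2 * ρ ^ 2 * v ^ 2 := by
  simp_rw [higgs_action_density hρ, integral_const_mul, integral_density hρ]
  field_simp
  ring
end
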